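/- Let K be a tame family of compact subsets of a strongly locally homogeneous completely metrizable space X, and let A, B be dense K-tame decompositions of X. Then the set of (A,B)-liftable homeomorphisms is dense in the homeomorphism space H°(A°, B°) of homeomorphisms of pairs (X/A, A°) → (X/B, B°), endowed with the strong limitation topology. -/

import Mathlib

open Set Topology unitInterval

noncomputable section

/-! ### General notions -/

/-- `X` is completely metrizable: its topology is generated by a complete metric. -/
def CompletelyMetrizable (X : Type*) [t : TopologicalSpace X] : Prop :=
  ∃ m : MetricSpace X, m.toUniformSpace.toTopologicalSpace = t ∧
    @CompleteSpace X m.toUniformSpace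

/-- The model cube `I^n` for `n ≤ ω`: `some k` codes the finite cube `I^k`,
`none` codes the Hilbert cube `I^ω`. -/
def ModelCube : Option ℕ → Type
  | some k => Fin k → unitInterval
  | none => ℕ → unitInterval

instance : (n : Option ℕ) → TopologicalSpace (ModelCube n)
  | some k => inferInstanceAs (TopologicalSpace (Fin k → unitInterval))
  | none => inferInstanceAs (TopologicalSpace (ℕ → unitInterval))

/-- A manifold modeled on `E`: a paracompact space each point of which has an open
neighborhood homeomorphic to an open subset of `E`. -/
def IsManifoldModeledOn (M : Type*) [TopologicalSpace M] (E : Type*) [TopologicalSpace E] :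
    Prop :=
  ParacompactSpace M ∧
    ∀ x : M, ∃ O : Set M, IsOpen O ∧ x ∈ O ∧ ∃ U : Set E, IsOpen U ∧ Nonempty (↥O ≃ₜ ↥U)

/-- The pair `(X, A)` is homeomorphic to the pair `(Y, B)`. -/
def PairHomeo {X Y : Type*} [TopologicalSpace X] [TopologicalSpace Y]
    (A : Set X) (B : Set Y) : Prop :=
  ∃ e : X ≃ₜ Y, ⇑e '' A = B

/-- The cube `I^n` sitting inside `ℝ^n`. -/
def stdCube (n : ℕ) : Set (Fin n → ℝ) := {f | ∀ i, f i ∈ Icc (0 : ℝ) 1}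

/-- The copy of `I^ω × [0,1]` sitting inside `I^ω × [0,2)`. -/
def hilbertCollar : Set ((ℕ → unitInterval) × ↥(Ico (0 : ℝ) 2)) := {p | (p.2 : ℝ) ≤ 1}

/-- The Hilbert cube `I^ω`. -/
abbrev HilbertCube : Type := ℕ → unitInterval

/-- The space `I^ω × [0,1)`. -/
abbrev HilbertHalfOpen : Type := HilbertCube × ↥(Ico (0 : ℝ) 1)

/-- `B` is a tame ball in the `I^n`-manifold `M`: it has an open neighborhood `O` such
that the pair `(O, B)` is homeomorphic to `(ℝ^n, I^n)` (for finite `n`), resp. to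
`(I^ω × [0,2), I^ω × [0,1])` (for `n = ω`). -/
def IsTameBall (n : Option ℕ) {M : Type*} [TopologicalSpace M] (B : Set M) : Prop :=
  ∃ O : Set M, IsOpen O ∧ B ⊆ O ∧
    match n with
    | some k => PairHomeo {x : ↥O | (x : M) ∈ B} (stdCube k)
    | none => PairHomeo {x : ↥O | (x : M) ∈ B} hilbertCollar

/-- The family of all tame balls of the `I^n`-manifold `X`. -/
def tameBalls (n : Option ℕ) (X : Type*) [TopologicalSpace X] : Set (Set X) :=
  {B | IsTameBall n B}

/-- A family of subsets of `X` is vanishing if for any open cover `𝒰` of `X` the subfamily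
of sets contained in no member of `𝒰` is locally finite in `X`. -/
def VanishingFamily {X : Type*} [TopologicalSpace X] (F : Set (Set X)) : Prop :=
  ∀ 𝒰 : Set (Set X), (∀ u ∈ 𝒰, IsOpen u) → ⋃₀ 𝒰 = univ →
    LocallyFinite (fun A : {A : Set X // A ∈ F ∧ ∀ u ∈ 𝒰, ¬ A ⊆ u} => (A : Set X))

/-- The family of connected components of the complement of `S`. -/
def complComponents {X : Type*} [TopologicalSpace X] (S : Set X) : Set (Set X) :=
  {C | ∃ x ∈ Sᶜ, C = connectedComponentIn Sᶜ x}

/-- A spongy subset of an `I^n`-manifold. -/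
def IsSpongy (n : Option ℕ) {M : Type*} [TopologicalSpace M] (S : Set M) : Prop :=
  IsClosed S ∧ IsNowhereDense S ∧
  VanishingFamily (complComponents S) ∧
  (∀ C ∈ complComponents S, ∀ C' ∈ complComponents S, C ≠ C' →
    closure C ∩ closure C' = ∅) ∧
  ∀ C ∈ complComponents S, IsTameBall n (closure C)

/-- `S` is a universal nowhere dense subset of `M`. -/
def UniversalNowhereDense {M : Type*} [TopologicalSpace M] (S : Set M) : Prop :=
  IsNowhereDense S ∧ ∀ A : Set M, IsNowhereDense A → ∃ h : M ≃ₜ M, ⇑h '' A ⊆ S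

/-- `(f, g) ≺ 𝒜` : for each `z` with `f z ≠ g z` the doubleton `{f z, g z}` lies in some
member of `𝒜`. -/
def Near {Z X : Type*} (f g : Z → X) (𝒜 : Set (Set X)) : Prop :=
  ∀ z : Z, f z ≠ g z → ∃ A ∈ 𝒜, f z ∈ A ∧ g z ∈ A

/-- The star `St(A, 𝒰)` of a set `A` with respect to a family `𝒰`. -/
def covStar {X : Type*} (A : Set X) (𝒰 : Set (Set X)) : Set X :=
  ⋃₀ {u ∈ 𝒰 | (u ∩ A).Nonempty}

/-- A compact set `K ⊆ X` is locally shrinkable if for each open neighborhood `O` of `K`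
and each open cover `𝒱` of `O` there is a homeomorphism of `X` supported in `O` moving `K`
into a member of `𝒱`. -/
def LocallyShrinkable {X : Type*} [TopologicalSpace X] (K : Set X) : Prop :=
  ∀ O : Set X, IsOpen O → K ⊆ O →
    ∀ 𝒱 : Set (Set X), (∀ v ∈ 𝒱, IsOpen v ∧ v ⊆ O) → O ⊆ ⋃₀ 𝒱 →
      ∃ h : X ≃ₜ X, (∀ x ∉ O, h x = x) ∧ ∃ v ∈ 𝒱, ⇑h '' K ⊆ v

/-- A family of sets is ambiently invariant if it is invariant under images of
homeomorphisms of the ambient space. -/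
def AmbientlyInvariant {X : Type*} [TopologicalSpace X] (𝒦 : Set (Set X)) : Prop :=
  ∀ h : X ≃ₜ X, ∀ K ∈ 𝒦, ⇑h '' K ∈ 𝒦

/-- The local shift property of a family of sets. -/
def LocalShiftProperty {X : Type*} [TopologicalSpace X] (𝒦 : Set (Set X)) : Prop :=
  ∀ x : X, ∀ O ∈ 𝓝 x, ∃ U ∈ 𝓝 x, U ⊆ O ∧
    ∀ A ∈ 𝒦, ∀ B ∈ 𝒦, A ⊆ U → B ⊆ U →
      ∃ h : X ≃ₜ X, ⇑h '' A = B ∧ ∀ y ∉ O, h y = y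

/-- A tame family of compact subsets of `X`. -/
def IsTameFamily {X : Type*} [TopologicalSpace X] (𝒦 : Set (Set X)) : Prop :=
  (∀ K ∈ 𝒦, IsCompact K) ∧ AmbientlyInvariant 𝒦 ∧ (∀ K ∈ 𝒦, LocallyShrinkable K) ∧
    LocalShiftProperty 𝒦 ∧ ∀ U : Set X, IsOpen U → U.Nonempty → ∃ K ∈ 𝒦, K ⊆ U

/-- `X` is strongly locally homogeneous. -/
def StronglyLocallyHomogeneous (X : Type*) [TopologicalSpace X] : Prop :=
  ∀ x : X, ∀ O ∈ 𝓝 x, ∃ U ∈ 𝓝 x, U ⊆ O ∧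
    ∀ y ∈ U, ∃ h : X ≃ₜ X, h x = y ∧ ∀ z ∉ O, h z = z

/-- `X` is topologically homogeneous. -/
def TopologicallyHomogeneous (X : Type*) [TopologicalSpace X] : Prop :=
  ∀ x y : X, ∃ h : X ≃ₜ X, h x = y

/-- `A` is σ-discrete in `X`: a countable union of closed discrete subsets of `X`. -/
def SigmaDiscrete {X : Type*} [TopologicalSpace X] (A : Set X) : Prop :=
  ∃ f : ℕ → Set X, A = ⋃ n, f n ∧ ∀ n, IsClosed (f n) ∧ DiscreteTopology ↥(f n)

/-! ### Decompositions -/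

/-- A decomposition of a topological space `X`: a cover of `X` by pairwise disjoint
nonempty compact subsets. -/
structure Decomposition (X : Type*) [TopologicalSpace X] where
  pieces : Set (Set X)
  nonempty' : ∀ A ∈ pieces, A.Nonempty
  isCompact' : ∀ A ∈ pieces, IsCompact A
  disjoint' : ∀ A ∈ pieces, ∀ B ∈ pieces, A ≠ B → Disjoint A B
  covers : ∀ x : X, ∃ A ∈ pieces, x ∈ A

namespace Decomposition

variable {X : Type*} [TopologicalSpace X] (D : Decomposition X)

/-- The decomposition space `X/D` (as a set it is the set of pieces). -/
def Space : Type _ := {A : Set X // A ∈ D.pieces}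

/-- The quotient map `q_D : X → X/D`. -/
noncomputable def q (x : X) : D.Space := ⟨(D.covers x).choose, (D.covers x).choose_spec.1⟩

/-- The quotient topology on the decomposition space. -/
instance : TopologicalSpace D.Space := TopologicalSpace.coinduced D.q inferInstance

/-- The non-degeneracy part `D°` of a decomposition, viewed inside the decomposition
space. -/
def nondeg : Set D.Space := {A | ¬ (A.1 : Set X).Subsingleton}

/-- The union of the non-degenerate pieces of a decomposition. -/
def nondegUnion : Set X := ⋃₀ {A ∈ D.pieces | ¬ A.Subsingleton}

/-- A `D`-saturated subset of `X`. -/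
def Saturated (U : Set X) : Prop := ∀ A ∈ D.pieces, (A ∩ U).Nonempty → A ⊆ U

/-- A decomposition is upper semicontinuous if saturations of closed sets are closed. -/
def IsUSC : Prop :=
  ∀ F : Set X, IsClosed F → IsClosed (⋃₀ {A ∈ D.pieces | (A ∩ F).Nonempty})

/-- A decomposition is vanishing if for every open cover `𝒰` of `X` the family of pieces
contained in no member of `𝒰` is discrete in `X`. -/
def Vanishing : Prop :=
  ∀ 𝒰 : Set (Set X), (∀ u ∈ 𝒰, IsOpen u) → ⋃₀ 𝒰 = univ →
    ∀ x : X, ∃ V ∈ 𝓝 x, ∀ A ∈ D.pieces, (∀ u ∈ 𝒰, ¬ A ⊆ u) →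
      ∀ B ∈ D.pieces, (∀ u ∈ 𝒰, ¬ B ⊆ u) →
        (V ∩ A).Nonempty → (V ∩ B).Nonempty → A = B

/-- The restriction of `D` to a (`D`-saturated open) set `U` is shrinkable: for each
`D`-saturated open cover `𝒰` of `U` and each open cover `𝒱` of `U` there is a
homeomorphism `h` of the subspace `U` with `(h, id) ≺ 𝒰` and `{h(A) : A ∈ D, A ⊆ U} ≺ 𝒱`. -/
def ShrinkableOn (U : Set X) : Prop :=
  ∀ 𝒰 : Set (Set X),
    (∀ u ∈ 𝒰, IsOpen u ∧ u ⊆ U ∧ ∀ A ∈ D.pieces, A ⊆ U → (A ∩ u).Nonempty → A ⊆ u) →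
    U ⊆ ⋃₀ 𝒰 →
    ∀ 𝒱 : Set (Set X), (∀ v ∈ 𝒱, IsOpen v ∧ v ⊆ U) → U ⊆ ⋃₀ 𝒱 →
      ∃ h : ↥U ≃ₜ ↥U,
        Near (fun x : ↥U => (h x : X)) (fun x : ↥U => (x : X)) 𝒰 ∧
        ∀ A ∈ D.pieces, A ⊆ U →
          ∃ v ∈ 𝒱, (fun x : ↥U => (x : X)) '' (⇑h '' {x : ↥U | (x : X) ∈ A}) ⊆ v

/-- A decomposition is strongly shrinkable if its restriction to any `D`-saturated open
set is shrinkable. -/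
def StronglyShrinkable : Prop :=
  ∀ U : Set X, IsOpen U → D.Saturated U → D.ShrinkableOn U

/-- A decomposition is `𝒦`-tame if it is vanishing, strongly shrinkable, and all its
non-degenerate pieces belong to `𝒦`. -/
def KTame (𝒦 : Set (Set X)) : Prop :=
  D.Vanishing ∧ D.StronglyShrinkable ∧ ∀ A ∈ D.pieces, ¬ A.Subsingleton → A ∈ 𝒦

/-- A decomposition is dense if its non-degeneracy part is dense in the decomposition
space. -/
def IsDenseDecomp : Prop := Dense D.nondeg

/-- A decomposition is discrete if its non-degeneracy part is closed and discrete in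
the decomposition space. -/
def IsDiscreteDecomp : Prop := IsClosed D.nondeg ∧ DiscreteTopology ↥D.nondeg

end Decomposition

/-- A homeomorphism `φ : X/A → X/B` is `(A,B)`-liftable if it lifts to a homeomorphism
`Φ : X → X` with `q_B ∘ Φ = φ ∘ q_A`. -/
def Liftable {X : Type*} [TopologicalSpace X] (A B : Decomposition X)
    (φ : A.Space ≃ₜ B.Space) : Prop :=
  ∃ Φ : X ≃ₜ X, ∀ x : X, B.q (Φ x) = φ (A.q x)

/-- Two decompositions of `X` are topologically equivalent if some homeomorphism of `X`
maps the first family of pieces onto the second. -/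
def TopEquivDecomp {X : Type*} [TopologicalSpace X] (A B : Decomposition X) : Prop :=
  ∃ Φ : X ≃ₜ X, (fun S : Set X => ⇑Φ '' S) '' A.pieces = B.pieces

/-- A `𝒦`-spongy subset of `X`. -/
def IsKSpongy {X : Type*} [TopologicalSpace X] (𝒦 : Set (Set X)) (S : Set X) : Prop :=
  ∃ D : Decomposition X, D.KTame 𝒦 ∧ D.IsDenseDecomp ∧
    Sᶜ = ⋃ A ∈ D.pieces, interior A

/-! ### Shape notions -/

/-- `K` is point-like in `X`. -/
def PointLike {X : Type*} [TopologicalSpace X] (K : Set X) : Prop :=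
  ∀ N : Set X, IsClosed N → K ⊆ interior N →
    ∃ x ∈ interior N, Nonempty (↥(N \ K) ≃ₜ ↥(N \ {x}))

/-- `K` is contractible in `U`: the inclusion `K ↪ U` is homotopic to a constant map. -/
def ContractibleIn {X : Type*} [TopologicalSpace X] (K U : Set X) : Prop :=
  ∃ hKU : K ⊆ U, ∃ y : ↥U,
    (ContinuousMap.mk (Set.inclusion hKU) (continuous_inclusion hKU)).Homotopic
      (ContinuousMap.const ↥K y)

/-- `K` is cell-like in `X`: `K` is contractible in each of its neighborhoods. -/
def CellLike {X : Type*} [TopologicalSpace X] (K : Set X) : Prop :=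
  ∀ U : Set X, IsOpen U → K ⊆ U → ContractibleIn K U

/-- `K` is cellular (with model `E`): every neighborhood of `K` contains a neighborhood
of `K` homeomorphic to `E`. -/
def CellularIn (E : Type*) [TopologicalSpace E] {X : Type*} [TopologicalSpace X]
    (K : Set X) : Prop :=
  ∀ U : Set X, IsOpen U → K ⊆ U → ∃ V ∈ 𝓝ˢ K, V ⊆ U ∧ Nonempty (↥V ≃ₜ E)

/-- `X` is locally contractible. -/
def LocallyContractible (X : Type*) [TopologicalSpace X] : Prop :=
  ∀ x : X, ∀ U ∈ 𝓝 x, ∃ V ∈ 𝓝 x, V ⊆ U ∧ ContractibleIn V U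

/-! ### Pieces and saturated sets -/

namespace Decomposition

section Basic

variable {X : Type*} [TopologicalSpace X] (D : Decomposition X)

lemma mem_q (x : X) : x ∈ (D.q x).1 := (D.covers x).choose_spec.2

lemma q_mem_pieces (x : X) : (D.q x).1 ∈ D.pieces := (D.q x).2

variable {D}

lemma eq_of_mem {P Q : Set X} (hP : P ∈ D.pieces) (hQ : Q ∈ D.pieces) {x : X} (hxP : x ∈ P)
    (hxQ : x ∈ Q) : P = Q := by
  by_contra h
  exact Set.disjoint_left.1 (D.disjoint' P hP Q hQ h) hxP hxQ

lemma q_eq_of_mem {P : Set X} (hP : P ∈ D.pieces) {x : X} (hx : x ∈ P) : D.q x = ⟨P, hP⟩ :=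
  Subtype.ext (eq_of_mem (D.q_mem_pieces x) hP (D.mem_q x) hx)

lemma q_eq_iff {x y : X} : D.q x = D.q y ↔ x ∈ (D.q y).1 := by
  constructor
  · intro h
    rw [← h]
    exact D.mem_q x
  · intro h
    exact q_eq_of_mem (D.q_mem_pieces y) h

lemma q_surjective : Function.Surjective D.q := by
  rintro ⟨P, hP⟩
  obtain ⟨x, hx⟩ := D.nonempty' P hP
  exact ⟨x, q_eq_of_mem hP hx⟩

lemma isOpen_iff {s : Set D.Space} : IsOpen s ↔ IsOpen (D.q ⁻¹' s) := Iff.rfl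

lemma continuous_q : Continuous D.q := continuous_coinduced_rng

lemma continuous_iff {Z : Type*} [TopologicalSpace Z] {g : D.Space → Z} :
    Continuous g ↔ Continuous (g ∘ D.q) := continuous_coinduced_dom

lemma saturated_preimage (s : Set D.Space) : D.Saturated (D.q ⁻¹' s) := by
  rintro P hP ⟨x, hxP, hx⟩ y hy
  simp only [mem_preimage, q_eq_of_mem hP hxP, q_eq_of_mem hP hy] at hx ⊢
  exact hx

lemma Saturated.q_mem {U : Set X} (hU : D.Saturated U) {x : X} (hx : x ∈ U) :
    (D.q x).1 ⊆ U :=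
  hU _ (D.q_mem_pieces x) ⟨x, D.mem_q x, hx⟩

lemma Saturated.preimage_image {U : Set X} (hU : D.Saturated U) : D.q ⁻¹' (D.q '' U) = U := by
  ext x
  constructor
  · rintro ⟨y, hy, hyx⟩
    exact hU.q_mem hy (q_eq_iff.1 hyx.symm)
  · exact fun hx => ⟨x, hx, rfl⟩

lemma saturated_of_nondeg_subset {V : Set X}
    (h : ∀ P ∈ D.pieces, ¬ P.Subsingleton → P ⊆ V) : D.Saturated V := by
  rintro P hP ⟨x, hxP, hxV⟩
  by_cases hs : P.Subsingleton
  · intro y hy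
    rwa [hs hy hxP]
  · exact h P hP hs

variable (D) in
/-- The largest `D`-saturated subset of `O`. -/
def core (O : Set X) : Set X := {x | (D.q x).1 ⊆ O}

lemma core_subset {O : Set X} : D.core O ⊆ O := fun x hx => hx (D.mem_q x)

lemma core_saturated {O : Set X} : D.Saturated (D.core O) := by
  rintro P hP ⟨x, hxP, hx⟩ y hy
  have hx' : (D.q x).1 ⊆ O := hx
  change (D.q y).1 ⊆ O
  rw [q_eq_of_mem hP hxP] at hx'
  rwa [q_eq_of_mem hP hy]

lemma subset_core {O P : Set X} (hP : P ∈ D.pieces) (h : P ⊆ O) : P ⊆ D.core O := by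
  intro x hx
  change (D.q x).1 ⊆ O
  rwa [q_eq_of_mem hP hx]

end Basic

section Vanishing

variable {X : Type*} [TopologicalSpace X] [T2Space X] [RegularSpace X] {D : Decomposition X}

lemma Vanishing.exists_nhds (hv : D.Vanishing) {x : X} {O : Set X} (hO : O ∈ 𝓝 x) :
    ∃ N ∈ 𝓝 x, ∀ P ∈ D.pieces, x ∉ P → (P ∩ N).Nonempty → P ⊆ O := by
  obtain ⟨W, hxW, hWc, hWO⟩ := exists_mem_nhds_isClosed_subset
    (interior_mem_nhds.2 hO)
  obtain ⟨V, hV, hVu⟩ := hv {interior O, Wᶜ} (by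
    rintro u (rfl | rfl)
    · exact isOpen_interior
    · exact hWc.isOpen_compl) (by
    ext y
    simp only [sUnion_insert, sUnion_singleton, mem_union, mem_compl_iff, mem_univ, iff_true]
    by_cases hy : y ∈ W
    · exact Or.inl (hWO hy)
    · exact Or.inr hy) x
  have bad : ∀ P ∈ D.pieces, ¬ P ⊆ O → (P ∩ W).Nonempty →
      ∀ u ∈ ({interior O, Wᶜ} : Set (Set X)), ¬ P ⊆ u := by
    rintro P hP hPO ⟨y, hyP, hyW⟩ u (rfl | rfl) hPu
    · exact hPO (hPu.trans interior_subset)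
    · exact hPu hyP hyW
  by_cases hQ : ∃ Q ∈ D.pieces, ¬ Q ⊆ O ∧ (Q ∩ W).Nonempty ∧ (V ∩ Q).Nonempty ∧ x ∉ Q
  · obtain ⟨Q, hQ, hQO, hQW, hVQ, hxQ⟩ := hQ
    refine ⟨V ∩ W ∩ Qᶜ, Filter.inter_mem (Filter.inter_mem hV hxW)
      ((D.isCompact' Q hQ).isClosed.isOpen_compl.mem_nhds hxQ), ?_⟩
    rintro P hP hxP ⟨y, hyP, ⟨hyV, hyW⟩, hyQ⟩
    by_contra hPO
    have := hVu P hP (bad P hP hPO ⟨y, hyP, hyW⟩) Q hQ (bad Q hQ hQO hQW) ⟨y, hyV, hyP⟩ hVQ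
    exact hyQ (this ▸ hyP)
  · refine ⟨V ∩ W, Filter.inter_mem hV hxW, ?_⟩
    rintro P hP hxP ⟨y, hyP, hyV, hyW⟩
    by_contra hPO
    exact hQ ⟨P, hP, hPO, ⟨y, hyP, hyW⟩, ⟨y, hyV, hyP⟩, hxP⟩

lemma Vanishing.isOpen_core (hv : D.Vanishing) {O : Set X} (hO : IsOpen O) :
    IsOpen (D.core O) := by
  rw [isOpen_iff_mem_nhds]
  intro x hx
  obtain ⟨N, hN, h⟩ := hv.exists_nhds (hO.mem_nhds (core_subset hx))
  refine Filter.mem_of_superset hN fun y hy => ?_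
  by_cases hxy : x ∈ (D.q y).1
  · exact core_saturated _ (D.q_mem_pieces y) ⟨x, hxy, hx⟩ (D.mem_q y)
  · exact h _ (D.q_mem_pieces y) hxy ⟨y, D.mem_q y, hy⟩

end Vanishing

variable {X : Type*} [MetricSpace X] {D : Decomposition X}

/-- Refinement of a cover of the pieces in `U` by saturated open sets that become small near the
complement of `U`. -/
lemma Vanishing.exists_fine_cover (hv : D.Vanishing) {U : Set X} (hU : IsOpen U)
    {𝒢 : Set (Set X)} (h𝒢o : ∀ g ∈ 𝒢, IsOpen g)
    (h𝒢 : ∀ P ∈ D.pieces, P ⊆ U → ∃ g ∈ 𝒢, P ⊆ g) :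
    ∃ 𝒢' : Set (Set X), (∀ g ∈ 𝒢', IsOpen g ∧ D.Saturated g ∧ g ⊆ U ∧ ∃ g₀ ∈ 𝒢, g ⊆ g₀) ∧
      (∀ P ∈ D.pieces, P ⊆ U → ∃ g ∈ 𝒢', P ⊆ g) ∧
      ∀ x ∉ U, ∀ O ∈ 𝓝 x, ∃ N ∈ 𝓝 x, ∀ g ∈ 𝒢', (g ∩ N).Nonempty → g ⊆ O := by
  have key : ∀ P : {P : Set X // P ∈ D.pieces ∧ P ⊆ U}, ∃ r > 0, ∃ g₀ ∈ 𝒢, P.1 ⊆ g₀ ∧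
      ∀ p ∈ P.1, ∀ x ∉ U, 2 * r ≤ dist p x := by
    rintro ⟨P, hP, hPU⟩
    obtain ⟨g₀, hg₀, hPg⟩ := h𝒢 P hP hPU
    obtain ⟨δ, hδ, hδU⟩ := (D.isCompact' P hP).exists_thickening_subset_open hU hPU
    refine ⟨δ / 2, by positivity, g₀, hg₀, hPg, fun p hp x hx => ?_⟩
    by_contra hlt
    refine hx (hδU (Metric.mem_thickening_iff.2 ⟨p, hp, ?_⟩))
    rw [dist_comm]
    linarith
  choose r hr g₀ hg₀ hPg hrd using key
  refine ⟨range fun P : {P : Set X // P ∈ D.pieces ∧ P ⊆ U} =>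
    D.core (g₀ P ∩ U ∩ Metric.thickening (r P) P.1), ?_, ?_, ?_⟩
  · rintro _ ⟨P, rfl⟩
    exact ⟨hv.isOpen_core (((h𝒢o _ (hg₀ P)).inter hU).inter Metric.isOpen_thickening),
      core_saturated, core_subset.trans (inter_subset_left.trans inter_subset_right),
      g₀ P, hg₀ P, core_subset.trans (inter_subset_left.trans inter_subset_left)⟩
  · intro P hP hPU
    exact ⟨_, ⟨⟨P, hP, hPU⟩, rfl⟩, subset_core hP
      (subset_inter (subset_inter (hPg ⟨P, hP, hPU⟩) hPU)
        (Metric.self_subset_thickening (hr ⟨P, hP, hPU⟩) _))⟩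
  · intro x hx O hO
    obtain ⟨ε, hε, hεO⟩ := Metric.mem_nhds_iff.1 hO
    obtain ⟨N, hN, hNP⟩ := hv.exists_nhds (Metric.ball_mem_nhds x (half_pos hε))
    obtain ⟨δ, hδ, hδN⟩ := Metric.mem_nhds_iff.1 hN
    refine ⟨Metric.ball x (min (δ / 2) (ε / 2)), Metric.ball_mem_nhds _ (by positivity), ?_⟩
    rintro _ ⟨⟨P, hP, hPU⟩, rfl⟩ ⟨y, hy, hyx⟩
    have hyr := (core_subset hy).2
    obtain ⟨p, hp, hyp⟩ := Metric.mem_thickening_iff.1 hyr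
    have hpx := hrd ⟨P, hP, hPU⟩ p hp x hx
    set ρ := r ⟨P, hP, hPU⟩
    have h1 := dist_triangle p y x
    rw [dist_comm p y] at h1
    have h2 : dist y x < min (δ / 2) (ε / 2) := hyx
    have h3 := min_le_left (δ / 2) (ε / 2)
    have h4 := min_le_right (δ / 2) (ε / 2)
    have hPO := hNP P hP (fun hxP => hx (hPU hxP))
      ⟨p, hp, hδN (Metric.mem_ball.2 (by linarith))⟩
    intro z hz
    obtain ⟨p', hp', hzp'⟩ := Metric.mem_thickening_iff.1 (core_subset hz).2
    have h5 := Metric.mem_ball.1 (hPO hp')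
    have h6 := dist_triangle z p' x
    exact hεO (Metric.mem_ball.2 (by linarith))

lemma Vanishing.exists_barycentric (hv : D.Vanishing) (𝒲 : Set (Set X))
    (h𝒲 : ∀ w ∈ 𝒲, IsOpen w ∧ D.Saturated w) :
    ∃ 𝒢 : Set (Set X), (∀ g ∈ 𝒢, IsOpen g ∧ D.Saturated g) ∧ ⋃₀ 𝒢 = ⋃₀ 𝒲 ∧
      ∀ z ∈ ⋃₀ 𝒲, ∃ w ∈ 𝒲, ∀ g ∈ 𝒢, z ∈ g → g ⊆ w := by
  set V := ⋃₀ 𝒲 with hVdef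
  have hV : IsOpen V := isOpen_sUnion fun w hw => (h𝒲 w hw).1
  have hVs : D.Saturated V := by
    rintro P hP ⟨x, hxP, w, hw, hxw⟩
    exact ((h𝒲 w hw).2 P hP ⟨x, hxP, hxw⟩).trans (subset_sUnion_of_mem hw)
  obtain ⟨v, hvo, hvU, hvlf, hvw⟩ := precise_refinement (X := V)
    (fun w : 𝒲 => ((↑) : V → X) ⁻¹' w.1) (fun w => (h𝒲 _ w.2).1.preimage continuous_subtype_val)
    (by
      ext ⟨x, hx⟩
      obtain ⟨w, hw, hxw⟩ := hx
      simpa using ⟨w, hw, hxw⟩)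
  obtain ⟨f, hfU, hfc, hfv⟩ := exists_iUnion_eq_closed_subset hvo (fun x => hvlf.point_finite x) hvU
  have hflf : LocallyFinite f := hvlf.subset hfv
  have hcl : ∀ p : 𝒲 → Prop, IsClosed (⋃ w : {w : 𝒲 // p w}, f w) := fun p =>
    (hflf.comp_injective Subtype.val_injective).isClosed_iUnion fun w => hfc _
  let M : Set X → Set X := fun P =>
    ((↑) : V → X) '' (⋃ w : {w : 𝒲 // Disjoint (((↑) : V → X) '' f w) P}, f w)ᶜ ∩
      ⋂ w ∈ {w : 𝒲 | ¬ Disjoint (((↑) : V → X) '' f w) P}, w.1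
  have hMo : ∀ P ∈ D.pieces, P ⊆ V → IsOpen (M P) := by
    intro P hP hPV
    refine (hV.isOpenMap_subtype_val _ (hcl _).isOpen_compl).inter ?_
    refine Set.Finite.isOpen_biInter ?_ fun w _ => (h𝒲 _ w.2).1
    have hc : IsCompact (((↑) : V → X) ⁻¹' P) :=
      (Topology.IsInducing.subtypeVal.isCompact_preimage_iff (by simpa using hPV)).2
        (D.isCompact' P hP)
    refine (hflf.finite_nonempty_inter_compact hc).subset fun w hw => ?_
    obtain ⟨_, ⟨x, hx, rfl⟩, hxP⟩ := Set.not_disjoint_iff.1 hw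
    exact ⟨x, hx, hxP⟩
  have hPM : ∀ P ∈ D.pieces, P ⊆ V → P ⊆ M P := by
    intro P hP hPV x hx
    refine ⟨⟨⟨x, hPV hx⟩, ?_, rfl⟩, ?_⟩
    · simp only [mem_compl_iff, mem_iUnion, not_exists]
      rintro ⟨w, hw⟩ hxf
      exact Set.disjoint_left.1 hw ⟨_, hxf, rfl⟩ hx
    · simp only [mem_iInter]
      intro w hw
      obtain ⟨_, ⟨y, hy, rfl⟩, hyP⟩ := Set.not_disjoint_iff.1 hw
      exact (h𝒲 _ w.2).2 P hP ⟨y, hyP, hvw _ (hfv _ hy)⟩ hx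
  refine ⟨{g | ∃ P ∈ D.pieces, P ⊆ V ∧ g = D.core (M P)}, ?_, ?_, ?_⟩
  · rintro _ ⟨P, hP, hPV, rfl⟩
    exact ⟨hv.isOpen_core (hMo P hP hPV), core_saturated⟩
  · apply Subset.antisymm
    · rintro x ⟨_, ⟨P, hP, hPV, rfl⟩, hx⟩
      obtain ⟨⟨y, -, rfl⟩, -⟩ := core_subset hx
      exact y.2
    · intro x hx
      exact ⟨_, ⟨_, D.q_mem_pieces x, hVs.q_mem hx, rfl⟩,
        subset_core (D.q_mem_pieces x) (hPM _ (D.q_mem_pieces x) (hVs.q_mem hx)) (D.mem_q x)⟩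
  · intro z hz
    have : (⟨z, hz⟩ : V) ∈ ⋃ w, f w := hfU ▸ mem_univ _
    obtain ⟨w, hw⟩ := mem_iUnion.1 this
    refine ⟨w.1, w.2, ?_⟩
    rintro _ ⟨P, hP, hPV, rfl⟩ hzg
    have hnd : ¬ Disjoint (((↑) : V → X) '' f w) P := by
      intro hd
      obtain ⟨⟨y, hy, hyz⟩, -⟩ := core_subset hzg
      refine hy (mem_iUnion.2 ⟨⟨w, hd⟩, ?_⟩)
      have : y = ⟨z, hz⟩ := Subtype.ext hyz
      rwa [this]
    intro y hy
    exact mem_iInter₂.1 (core_subset hy).2 w hnd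

/-- Saturated open star refinements. -/
lemma Vanishing.exists_star_refinement (hv : D.Vanishing) (𝒲 : Set (Set X))
    (h𝒲 : ∀ w ∈ 𝒲, IsOpen w ∧ D.Saturated w) :
    ∃ 𝒢 : Set (Set X), (∀ g ∈ 𝒢, IsOpen g ∧ D.Saturated g) ∧ ⋃₀ 𝒢 = ⋃₀ 𝒲 ∧
      ∀ g ∈ 𝒢, g.Nonempty → ∃ w ∈ 𝒲, ∀ g' ∈ 𝒢, (g' ∩ g).Nonempty → g' ⊆ w := by
  obtain ⟨𝒢₁, h₁, hU₁, hb₁⟩ := hv.exists_barycentric 𝒲 h𝒲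
  obtain ⟨𝒢₂, h₂, hU₂, hb₂⟩ := hv.exists_barycentric 𝒢₁ h₁
  refine ⟨𝒢₂, h₂, hU₂.trans hU₁, ?_⟩
  rintro g hg ⟨z, hz⟩
  have hz₂ : z ∈ ⋃₀ 𝒢₁ := hU₂ ▸ ⟨g, hg, hz⟩
  obtain ⟨w, hw, hwz⟩ := hb₁ z (hU₁ ▸ hz₂)
  refine ⟨w, hw, ?_⟩
  rintro g' hg' ⟨y, hyg', hyg⟩
  obtain ⟨k, hk, hky⟩ := hb₂ y (hU₂ ▸ ⟨g, hg, hyg⟩)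
  exact (hky g' hg' hyg').trans (hwz k hk (hky g hg hyg hz))

variable (X) in
/-- The decomposition of `X` into singletons. -/
def singletons : Decomposition X where
  pieces := range fun x : X => ({x} : Set X)
  nonempty' := by
    rintro _ ⟨x, rfl⟩
    exact singleton_nonempty x
  isCompact' := by
    rintro _ ⟨x, rfl⟩
    exact isCompact_singleton
  disjoint' := by
    rintro _ ⟨x, rfl⟩ _ ⟨y, rfl⟩ h
    simpa using fun hxy : x = y => h (by rw [hxy])
  covers x := ⟨{x}, ⟨x, rfl⟩, rfl⟩

lemma saturated_singletons (U : Set X) : (singletons X).Saturated U := by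
  rintro _ ⟨x, rfl⟩ ⟨y, rfl, hy⟩
  simpa using hy

lemma vanishing_singletons : (singletons X).Vanishing := by
  intro 𝒰 _ hU x
  refine ⟨univ, Filter.univ_mem, ?_⟩
  rintro _ ⟨y, rfl⟩ hy
  obtain ⟨u, hu, hyu⟩ := hU.symm ▸ mem_univ y
  exact absurd (singleton_subset_iff.2 hyu) (hy u hu)

end Decomposition

lemma exists_open_star_refinement {X : Type*} [MetricSpace X] (𝒲 : Set (Set X))
    (h𝒲 : ∀ w ∈ 𝒲, IsOpen w) :
    ∃ 𝒢 : Set (Set X), (∀ g ∈ 𝒢, IsOpen g) ∧ ⋃₀ 𝒢 = ⋃₀ 𝒲 ∧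
      ∀ g ∈ 𝒢, g.Nonempty → ∃ w ∈ 𝒲, ∀ g' ∈ 𝒢, (g' ∩ g).Nonempty → g' ⊆ w := by
  obtain ⟨𝒢, h, h'⟩ := Decomposition.vanishing_singletons.exists_star_refinement 𝒲
    fun w hw => ⟨h𝒲 w hw, Decomposition.saturated_singletons w⟩
  exact ⟨𝒢, fun g hg => (h g hg).1, h'⟩

/-! ### Extending and glueing homeomorphisms -/

section Glue

variable {X : Type*} [TopologicalSpace X]

lemma continuous_of_boundary_control {U : Set X} (hU : IsOpen U) {k : X → X}
    (hk : ContinuousOn k U) (hid : ∀ x ∉ U, k x = x)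
    (hb : ∀ x ∉ U, ∀ O ∈ 𝓝 x, ∃ N ∈ 𝓝 x, ∀ y ∈ N, y ∈ U → k y ∈ O) : Continuous k := by
  rw [continuous_iff_continuousAt]
  intro x
  by_cases hx : x ∈ U
  · exact hk.continuousAt (hU.mem_nhds hx)
  · intro O hO
    rw [hid x hx] at hO
    obtain ⟨N, hN, h⟩ := hb x hx O hO
    rw [Filter.mem_map]
    filter_upwards [hN, hO] with y hy hyO
    by_cases hyU : y ∈ U
    · exact h y hy hyU
    · rw [mem_preimage, hid y hyU]
      exact hyO

/-- A self-homeomorphism of an open set that is close to the identity near the boundary extends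
by the identity. -/
lemma exists_homeomorph_extend {U : Set X} (hU : IsOpen U) (h : U ≃ₜ U) {𝒢 : Set (Set X)}
    (hn : ∀ x : U, ∃ g ∈ 𝒢, (x : X) ∈ g ∧ (h x : X) ∈ g)
    (hb : ∀ x ∉ U, ∀ O ∈ 𝓝 x, ∃ N ∈ 𝓝 x, ∀ g ∈ 𝒢, (g ∩ N).Nonempty → g ⊆ O) :
    ∃ H : X ≃ₜ X, (∀ x ∉ U, H x = x) ∧ ∀ x : U, H x = h x := by
  classical
  have main : ∀ k : U ≃ₜ U, (∀ x : U, ∃ g ∈ 𝒢, (x : X) ∈ g ∧ (k x : X) ∈ g) →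
      Continuous (Equiv.Perm.ofSubtype (p := fun x => x ∈ U) k.toEquiv) := by
    intro k hk
    refine continuous_of_boundary_control hU ?_
      (fun x hx => Equiv.Perm.ofSubtype_apply_of_not_mem _ hx) ?_
    · rw [continuousOn_iff_continuous_domRestrict]
      refine (continuous_subtype_val.comp k.continuous).congr fun x => ?_
      exact (Equiv.Perm.ofSubtype_apply_of_mem (p := fun x => x ∈ U) k.toEquiv x.2).symm
    · intro x hx O hO
      obtain ⟨N, hN, h⟩ := hb x hx O hO
      refine ⟨N, hN, fun y hy hyU => ?_⟩
      obtain ⟨g, hg, h1, h2⟩ := hk ⟨y, hyU⟩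
      rw [Equiv.Perm.ofSubtype_apply_of_mem (p := fun x => x ∈ U) k.toEquiv hyU]
      exact h g hg ⟨y, h1, hy⟩ h2
  refine ⟨⟨Equiv.Perm.ofSubtype (p := fun x => x ∈ U) h.toEquiv, main h hn, ?_⟩,
    fun x hx => Equiv.Perm.ofSubtype_apply_of_not_mem _ hx,
    fun x => Equiv.Perm.ofSubtype_apply_of_mem (p := fun x => x ∈ U) h.toEquiv x.2⟩
  have h2 := main h.symm (fun x => by
    obtain ⟨g, hg, h1, h2⟩ := hn (h.symm x)
    exact ⟨g, hg, by simpa using h2, h1⟩)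
  have h3 : (Equiv.Perm.ofSubtype (p := fun x => x ∈ U) h.toEquiv).symm =
      Equiv.Perm.ofSubtype (p := fun x => x ∈ U) h.symm.toEquiv :=
    (map_inv (Equiv.Perm.ofSubtype (p := fun x => x ∈ U)) h.toEquiv).symm
  change Continuous (Equiv.Perm.ofSubtype (p := fun x => x ∈ U) h.toEquiv).symm
  rw [h3]
  exact h2

/-- Homeomorphisms supported in the members of a disjoint family which is locally trivial or
converges to the complement can be glued. -/
lemma exists_homeomorph_glue {ι : Type*} (O : ι → Set X)
    (hd : ∀ i j, (O i ∩ O j).Nonempty → i = j) (h : ι → X ≃ₜ X) (hid : ∀ i, ∀ x ∉ O i, h i x = x)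
    (hlf : ∀ x, (∃ N ∈ 𝓝 x, ∀ i j, (O i ∩ N).Nonempty → (O j ∩ N).Nonempty → i = j) ∨
      ((∀ i, x ∉ O i) ∧ ∀ S ∈ 𝓝 x, ∃ N ∈ 𝓝 x, ∀ i, (O i ∩ N).Nonempty → O i ⊆ S)) :
    ∃ H : X ≃ₜ X, (∀ i, ∀ x ∈ O i, H x = h i x) ∧ ∀ x, (∀ i, x ∉ O i) → H x = x := by
  classical
  let G : (ι → X ≃ₜ X) → X → X := fun k x =>
    if hx : ∃ i, x ∈ O i then k hx.choose x else x
  have G1 : ∀ k i, ∀ x ∈ O i, G k x = k i x := by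
    intro k i x hx
    have hex : ∃ i, x ∈ O i := ⟨i, hx⟩
    have : hex.choose = i := hd _ _ ⟨x, hex.choose_spec, hx⟩
    simp only [G, dif_pos hex, this]
  have G2 : ∀ k x, (∀ i, x ∉ O i) → G k x = x := by
    intro k x hx
    simp only [G]
    rw [dif_neg]
    rintro ⟨i, hi⟩
    exact hx i hi
  have Gc : ∀ k : ι → X ≃ₜ X, (∀ i, ∀ x ∉ O i, k i x = x) → Continuous (G k) := by
    intro k hk
    have hmaps : ∀ i, ∀ x ∈ O i, k i x ∈ O i := by
      intro i x hx
      by_contra hn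
      exact hn (by rwa [(k i).injective (hk i _ hn)])
    rw [continuous_iff_continuousAt]
    intro x
    rcases hlf x with ⟨N, hN, hu⟩ | ⟨hx, hS⟩
    · by_cases hex : ∃ i, (O i ∩ N).Nonempty
      · obtain ⟨i, hi⟩ := hex
        refine (k i).continuous.continuousAt.congr ?_
        filter_upwards [hN] with y hy
        by_cases hyi : y ∈ O i
        · exact (G1 k i y hyi).symm
        · rw [hk i y hyi, G2 k y]
          intro j hj
          exact hyi (hu i j hi ⟨y, hj, hy⟩ ▸ hj)
      · refine continuousAt_id.congr ?_
        filter_upwards [hN] with y hy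
        rw [G2 k y fun j hj => hex ⟨j, y, hj, hy⟩, id]
    · intro S hSx
      rw [G2 k x hx] at hSx
      obtain ⟨N, hN, h⟩ := hS S hSx
      rw [Filter.mem_map]
      filter_upwards [hN, hSx] with y hy hyS
      by_cases hex : ∃ i, y ∈ O i
      · obtain ⟨i, hi⟩ := hex
        rw [mem_preimage, G1 k i y hi]
        exact h i ⟨y, hi, hy⟩ (hmaps i y hi)
      · rw [mem_preimage, G2 k y fun i hi => hex ⟨i, hi⟩]
        exact hyS
  have hids : ∀ i, ∀ x ∉ O i, (h i).symm x = x := fun i x hx => by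
    rw [Homeomorph.symm_apply_eq, hid i x hx]
  have inv : ∀ k l : ι → X ≃ₜ X, (∀ i, ∀ x ∉ O i, k i x = x) → (∀ i x, l i (k i x) = x) →
      ∀ x, G l (G k x) = x := by
    intro k l hk hlk x
    by_cases hex : ∃ i, x ∈ O i
    · obtain ⟨i, hi⟩ := hex
      have : k i x ∈ O i := by
        by_contra hn
        exact hn (by rwa [(k i).injective (hk i _ hn)])
      rw [G1 k i x hi, G1 l i _ this, hlk]
    · have hx : ∀ i, x ∉ O i := fun i hi => hex ⟨i, hi⟩
      rw [G2 k x hx, G2 l x hx]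
  exact ⟨⟨⟨G h, G fun i => (h i).symm, inv _ _ hid fun i x => (h i).symm_apply_apply x,
    inv _ _ hids fun i x => (h i).apply_symm_apply x⟩, Gc h hid, Gc _ hids⟩, G1 h, G2 h⟩

end Glue

/-- Uniform limits of continuous maps with geometrically decreasing steps. -/
lemma exists_continuous_limit {Z X : Type*} [TopologicalSpace Z] [MetricSpace X] [CompleteSpace X]
    {f : ℕ → Z → X} (hf : ∀ n, Continuous (f n))
    (hd : ∀ n x, dist (f n x) (f (n + 1) x) ≤ (1 / 2) ^ n) :
    ∃ g : Z → X, Continuous g ∧ (∀ x, Filter.Tendsto (fun n => f n x) Filter.atTop (𝓝 (g x))) ∧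
      ∀ n x, dist (f n x) (g x) ≤ 2 * (1 / 2) ^ n := by
  have hd' : ∀ x n, dist (f n x) (f (n + 1) x) ≤ 2 / 2 / 2 ^ n := fun x n =>
    (hd n x).trans_eq (by simp)
  have hl : ∀ x, ∃ y, Filter.Tendsto (fun n => f n x) Filter.atTop (𝓝 y) := fun x =>
    cauchySeq_tendsto_of_complete (cauchySeq_of_le_geometric_two (hd' x))
  choose g hg using hl
  have hb : ∀ n x, dist (f n x) (g x) ≤ 2 * (1 / 2) ^ n := fun n x =>
    (dist_le_of_le_geometric_two_of_tendsto (hd' x) (hg x) n).trans_eq (by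
      rw [one_div, inv_pow, div_eq_mul_inv])
  refine ⟨g, ?_, hg, hb⟩
  have hu : TendstoUniformly f g Filter.atTop := by
    rw [Metric.tendstoUniformly_iff]
    intro ε hε
    have : Filter.Tendsto (fun n : ℕ => 2 * (1 / 2 : ℝ) ^ n) Filter.atTop (𝓝 (2 * 0)) :=
      (tendsto_pow_atTop_nhds_zero_of_lt_one (by norm_num) (by norm_num)).const_mul 2
    rw [mul_zero] at this
    filter_upwards [this.eventually_lt_const hε] with n hn x
    rw [dist_comm]
    exact (hb n x).trans_lt hn
  exact hu.continuous (Filter.Frequently.of_forall hf)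

namespace Decomposition

variable {X : Type*} [MetricSpace X] {D : Decomposition X}

variable (D) in
/-- Strong shrinkability in terms of homeomorphisms of the whole space. -/
def AmbientShrinkable : Prop :=
  ∀ U : Set X, IsOpen U → D.Saturated U →
    ∀ 𝒢 : Set (Set X), (∀ g ∈ 𝒢, IsOpen g) → (∀ P ∈ D.pieces, P ⊆ U → ∃ g ∈ 𝒢, P ⊆ g) →
    ∀ 𝒱 : Set (Set X), (∀ v ∈ 𝒱, IsOpen v) → U ⊆ ⋃₀ 𝒱 →
    ∃ h : X ≃ₜ X, (∀ x ∉ U, h x = x) ∧ (∀ x ∈ U, ∃ g ∈ 𝒢, x ∈ g ∧ h x ∈ g) ∧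
      ∀ P ∈ D.pieces, P ⊆ U → ∃ v ∈ 𝒱, h '' P ⊆ v

lemma Vanishing.ambientShrinkable (hv : D.Vanishing) (hs : D.StronglyShrinkable) :
    D.AmbientShrinkable := by
  intro U hU hUs 𝒢 h𝒢o h𝒢 𝒱 h𝒱o h𝒱
  obtain ⟨𝒢', h1, h2, h3⟩ := hv.exists_fine_cover hU h𝒢o h𝒢
  have h4 : U ⊆ ⋃₀ 𝒢' := fun x hx => by
    obtain ⟨g, hg, hPg⟩ := h2 _ (D.q_mem_pieces x) (hUs.q_mem hx)
    exact ⟨g, hg, hPg (D.mem_q x)⟩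
  obtain ⟨h, hn, hsm⟩ := hs U hU hUs 𝒢'
    (fun g hg => ⟨(h1 g hg).1, (h1 g hg).2.2.1, fun P hP _ => (h1 g hg).2.1 P hP⟩) h4
    ((fun v => v ∩ U) '' 𝒱)
    (by
      rintro _ ⟨v, hv, rfl⟩
      exact ⟨(h𝒱o v hv).inter hU, inter_subset_right⟩)
    (fun x hx => by
      obtain ⟨v, hv, hxv⟩ := h𝒱 hx
      exact ⟨_, ⟨v, hv, rfl⟩, hxv, hx⟩)
  have hn' : ∀ x : U, ∃ g ∈ 𝒢', (x : X) ∈ g ∧ (h x : X) ∈ g := by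
    intro x
    by_cases hx : (h x : X) = x
    · obtain ⟨g, hg, hxg⟩ := h4 x.2
      exact ⟨g, hg, hxg, hx.symm ▸ hxg⟩
    · obtain ⟨g, hg, h5, h6⟩ := hn x hx
      exact ⟨g, hg, h6, h5⟩
  obtain ⟨H, hH1, hH2⟩ := exists_homeomorph_extend hU h hn' h3
  refine ⟨H, hH1, ?_, ?_⟩
  · intro x hx
    obtain ⟨g, hg, h5, h6⟩ := hn' ⟨x, hx⟩
    obtain ⟨-, -, -, g₀, hg₀, hgg⟩ := h1 g hg
    exact ⟨g₀, hg₀, hgg h5, hgg (by rw [hH2 ⟨x, hx⟩]; exact h6)⟩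
  · intro P hP hPU
    obtain ⟨_, ⟨v, hv, rfl⟩, hPv⟩ := hsm P hP hPU
    refine ⟨v, hv, ?_⟩
    rintro _ ⟨x, hx, rfl⟩
    rw [hH2 ⟨x, hPU hx⟩]
    exact (hPv ⟨_, ⟨⟨x, hPU hx⟩, hx, rfl⟩, rfl⟩).1

end Decomposition

/-! ### Nearness with respect to covers -/

lemma exists_dependent_seq {α : Type*} {P : ℕ → α → Prop} {R : ℕ → α → α → Prop} {a₀ : α}
    (h₀ : P 0 a₀) (step : ∀ n a, P n a → ∃ b, P (n + 1) b ∧ R n a b) :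
    ∃ s : ℕ → α, s 0 = a₀ ∧ (∀ n, P n (s n)) ∧ ∀ n, R n (s n) (s (n + 1)) := by
  choose f hf hR using step
  let s : ∀ n, {a : α // P n a} := fun n =>
    Nat.rec ⟨a₀, h₀⟩ (fun n a => ⟨f n a.1 a.2, hf n a.1 a.2⟩) n
  exact ⟨fun n => (s n).1, rfl, fun n => (s n).2, fun n => hR n (s n).1 (s n).2⟩

/-- `x` and `y` coincide or lie in a common member of `𝒢`. -/
def CoverNear {X : Type*} (𝒢 : Set (Set X)) (x y : X) : Prop := x = y ∨ ∃ g ∈ 𝒢, x ∈ g ∧ y ∈ g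

/-- `𝒢` is a star refinement of `𝒲`. -/
def StarRefines {X : Type*} (𝒢 𝒲 : Set (Set X)) : Prop :=
  ∀ g ∈ 𝒢, g.Nonempty → ∃ w ∈ 𝒲, ∀ g' ∈ 𝒢, (g' ∩ g).Nonempty → g' ⊆ w

section CoverNear

variable {X : Type*} {𝒢 𝒲 : Set (Set X)} {x y z w : X}

lemma CoverNear.refl (𝒢 : Set (Set X)) (x : X) : CoverNear 𝒢 x x := Or.inl rfl

lemma CoverNear.symm (h : CoverNear 𝒢 x y) : CoverNear 𝒢 y x := by
  rcases h with rfl | ⟨g, hg, hx, hy⟩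
  · exact Or.inl rfl
  · exact Or.inr ⟨g, hg, hy, hx⟩

lemma CoverNear.exists_mem (h : CoverNear 𝒢 x y) (hx : x ∈ ⋃₀ 𝒢) : ∃ g ∈ 𝒢, x ∈ g ∧ y ∈ g := by
  rcases h with rfl | h
  · obtain ⟨g, hg, hxg⟩ := hx
    exact ⟨g, hg, hxg, hxg⟩
  · exact h

lemma StarRefines.refines (h : StarRefines 𝒢 𝒲) {g : Set X} (hg : g ∈ 𝒢) (hx : x ∈ g) :
    ∃ w ∈ 𝒲, g ⊆ w := by
  obtain ⟨w, hw, h'⟩ := h g hg ⟨x, hx⟩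
  exact ⟨w, hw, h' g hg ⟨x, hx, hx⟩⟩

lemma StarRefines.mono (h : StarRefines 𝒢 𝒲) (hxy : CoverNear 𝒢 x y) : CoverNear 𝒲 x y := by
  rcases hxy with rfl | ⟨g, hg, hx, hy⟩
  · exact Or.inl rfl
  · obtain ⟨w, hw, hgw⟩ := h.refines hg hx
    exact Or.inr ⟨w, hw, hgw hx, hgw hy⟩

lemma StarRefines.trans (h : StarRefines 𝒢 𝒲) (hxy : CoverNear 𝒢 x y) (hyz : CoverNear 𝒢 y z) :
    CoverNear 𝒲 x z := by
  rcases hxy with rfl | ⟨g, hg, hx, hy⟩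
  · exact h.mono hyz
  · rcases hyz with rfl | ⟨g', hg', hy', hz⟩
    · exact h.mono (Or.inr ⟨g, hg, hx, hy⟩)
    · obtain ⟨w, hw, hgw⟩ := h g hg ⟨x, hx⟩
      exact Or.inr ⟨w, hw, hgw g hg ⟨x, hx, hx⟩ hx, hgw g' hg' ⟨y, hy', hy⟩ hz⟩

lemma StarRefines.trans₃ (h : StarRefines 𝒢 𝒲) (hxy : CoverNear 𝒢 x y) (hyz : CoverNear 𝒢 y z)
    (hzw : CoverNear 𝒢 z w) : CoverNear 𝒲 x w := by
  rcases hyz with rfl | ⟨g, hg, hy, hz⟩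
  · exact h.trans hxy hzw
  · obtain ⟨v, hv, hgv⟩ := h g hg ⟨y, hy⟩
    have hgg := hgv g hg ⟨y, hy, hy⟩
    refine Or.inr ⟨v, hv, ?_, ?_⟩
    · rcases hxy with rfl | ⟨g', hg', hx, hy'⟩
      · exact hgg hy
      · exact hgv g' hg' ⟨y, hy', hy⟩ hx
    · rcases hzw with rfl | ⟨g', hg', hz', hw⟩
      · exact hgg hz
      · exact hgv g' hg' ⟨z, hz', hz⟩ hw

end CoverNear

/-! ### Shrinking a decomposition to a homeomorphism -/

lemma Homeomorph.mem_of_eq_self_off {X : Type*} [TopologicalSpace X] (h : X ≃ₜ X) {U : Set X}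
    (hid : ∀ x ∉ U, h x = x) {x : X} (hx : x ∈ U) : h x ∈ U := by
  by_contra hn
  exact hn (by rwa [h.injective (hid _ hn)])

lemma Homeomorph.symm_eq_self_off {X : Type*} [TopologicalSpace X] (h : X ≃ₜ X) {U : Set X}
    (hid : ∀ x ∉ U, h x = x) : ∀ x ∉ U, h.symm x = x := fun x hx => by
  rw [Homeomorph.symm_apply_eq, hid x hx]

namespace Decomposition

variable {X : Type*} [MetricSpace X] {D : Decomposition X}

lemma shrinking_step (hv : D.Vanishing) (hs : D.AmbientShrinkable) {V : Set X} (hV : IsOpen V)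
    (hVs : D.Saturated V) (a : X ≃ₜ X) {𝒰 : Set (Set X)} (h𝒰 : ∀ u ∈ 𝒰, IsOpen u ∧ D.Saturated u)
    (h𝒰V : ⋃₀ 𝒰 = V) (n : ℕ) :
    ∃ (t : X ≃ₜ X) (𝒰' : Set (Set X)), (∀ x ∉ V, t x = x) ∧ (∀ x, CoverNear 𝒰 x (t x)) ∧
      (∀ u ∈ 𝒰', IsOpen u ∧ D.Saturated u) ∧ ⋃₀ 𝒰' = V ∧ StarRefines 𝒰' 𝒰 ∧
      ∀ u ∈ 𝒰', u.Nonempty → (∀ x ∈ u, ∀ y ∈ u, dist (a (t x)) (a (t y)) ≤ (1 / 2) ^ n) ∧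
        ∃ P ∈ D.pieces, u ⊆ Metric.thickening ((1 / 2) ^ n) P := by
  have hpos : (0 : ℝ) < (1 / 2) ^ n := by positivity
  have hcov : ∀ P ∈ D.pieces, P ⊆ V → ∃ u ∈ 𝒰, P ⊆ u := by
    intro P hP hPV
    obtain ⟨x, hx⟩ := D.nonempty' P hP
    obtain ⟨u, hu, hxu⟩ := h𝒰V ▸ hPV hx
    exact ⟨u, hu, (h𝒰 u hu).2 P hP ⟨x, hx, hxu⟩⟩
  obtain ⟨t, ht1, ht2, ht3⟩ := hs V hV hVs 𝒰 (fun u hu => (h𝒰 u hu).1) hcov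
    (range fun x => a ⁻¹' Metric.ball x ((1 / 2) ^ n / 2))
    (by
      rintro _ ⟨x, rfl⟩
      exact Metric.isOpen_ball.preimage a.continuous)
    (fun x _ => ⟨_, ⟨a x, rfl⟩, by simp⟩)
  have hdist : ∀ c x y : X, x ∈ Metric.ball c ((1 / 2) ^ n / 2 : ℝ) →
      y ∈ Metric.ball c ((1 / 2) ^ n / 2 : ℝ) → dist x y ≤ (1 / 2) ^ n := by
    intro c x y hx hy
    have := dist_triangle_right x y c
    rw [Metric.mem_ball] at hx hy
    linarith
  let 𝒞 : Set (Set X) := {w | ∃ P ∈ D.pieces, ∃ c : X, ∃ u ∈ 𝒰, w = D.core (u ∩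
    ((a ∘ t) ⁻¹' Metric.ball c ((1 / 2) ^ n / 2) ∩ Metric.thickening ((1 / 2) ^ n) P))}
  obtain ⟨𝒰', h1, h2, h3⟩ := hv.exists_star_refinement 𝒞 (by
    rintro _ ⟨P, hP, c, u, hu, rfl⟩
    exact ⟨hv.isOpen_core ((h𝒰 u hu).1.inter ((Metric.isOpen_ball.preimage
      (a.continuous.comp t.continuous)).inter Metric.isOpen_thickening)), core_saturated⟩)
  refine ⟨t, 𝒰', ht1, ?_, h1, ?_, ?_, ?_⟩
  · intro x
    by_cases hx : x ∈ V
    · exact Or.inr (ht2 x hx)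
    · exact Or.inl (ht1 x hx).symm
  · rw [h2]
    apply Subset.antisymm
    · rintro x ⟨_, ⟨P, hP, c, u, hu, rfl⟩, hx⟩
      exact h𝒰V ▸ ⟨u, hu, (core_subset hx).1⟩
    · intro x hx
      have hPV := hVs.q_mem hx
      have hP := D.q_mem_pieces x
      obtain ⟨u, hu, hPu⟩ := hcov _ hP hPV
      obtain ⟨_, ⟨c, rfl⟩, hc⟩ := ht3 _ hP hPV
      refine ⟨_, ⟨_, hP, c, u, hu, rfl⟩, subset_core hP ?_ (D.mem_q x)⟩
      exact subset_inter hPu (subset_inter (fun y hy => hc ⟨y, hy, rfl⟩)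
        (Metric.self_subset_thickening hpos _))
  · intro g hg hne
    obtain ⟨_, ⟨P, hP, c, u, hu, rfl⟩, h⟩ := h3 g hg hne
    exact ⟨u, hu, fun g' hg' hn => (h g' hg' hn).trans (core_subset.trans inter_subset_left)⟩
  · intro g hg hne
    obtain ⟨_, ⟨P, hP, c, u, hu, rfl⟩, h⟩ := h3 g hg hne
    have hg' := (h g hg (by simpa using hne)).trans core_subset
    exact ⟨fun x hx y hy => hdist c _ _ (hg' hx).2.1 (hg' hy).2.1, P, hP,
      fun x hx => (hg' hx).2.2⟩

end Decomposition

namespace Decomposition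

variable {X : Type*} [MetricSpace X] [CompleteSpace X] {D : Decomposition X}

/-- Bing's shrinking criterion: a vanishing shrinkable decomposition space is homeomorphic to the
ambient space, by a homeomorphism close to the quotient map. -/
lemma Vanishing.exists_homeomorph_space (hv : D.Vanishing) (hs : D.AmbientShrinkable) {V : Set X}
    (hV : IsOpen V) (hVn : ∀ P ∈ D.pieces, ¬ P.Subsingleton → P ⊆ V) {𝒢 : Set (Set X)}
    (h𝒢o : ∀ g ∈ 𝒢, IsOpen g) (h𝒢 : ∀ P ∈ D.pieces, P ⊆ V → ∃ g ∈ 𝒢, P ⊆ g) :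
    ∃ G : D.Space ≃ₜ X, (∀ x ∉ V, G (D.q x) = x) ∧
      ∀ x ∈ V, G (D.q x) ∈ V ∧ ∃ g ∈ 𝒢, x ∈ g ∧ G (D.q x) ∈ g := by
  have hVs : D.Saturated V := saturated_of_nondeg_subset hVn
  obtain ⟨𝒢₁, hg1, hg1c, hE⟩ := hv.exists_fine_cover hV h𝒢o h𝒢
  obtain ⟨𝒢₂, hg2, hg2U, hg2s⟩ := hv.exists_star_refinement 𝒢₁ fun g hg =>
    ⟨(hg1 g hg).1, (hg1 g hg).2.1⟩
  obtain ⟨𝒢₃, hg3, hg3U, hg3s⟩ := hv.exists_star_refinement 𝒢₂ hg2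
  have hU1 : ⋃₀ 𝒢₁ = V := by
    apply Subset.antisymm (sUnion_subset fun g hg => (hg1 g hg).2.2.1)
    intro x hx
    obtain ⟨g, hg, hPg⟩ := hg1c _ (D.q_mem_pieces x) (hVs.q_mem hx)
    exact ⟨g, hg, hPg (D.mem_q x)⟩
  have hU2 : ⋃₀ 𝒢₂ = V := hg2U.trans hU1
  have hU3 : ⋃₀ 𝒢₃ = V := hg3U.trans hU2
  -- the inductive construction
  obtain ⟨s, hs0, hsP, hsR⟩ := exists_dependent_seq (α := (X ≃ₜ X) × Set (Set X))
    (P := fun _ c => (∀ x ∉ V, c.1 x = x) ∧ (∀ u ∈ c.2, IsOpen u ∧ D.Saturated u) ∧ ⋃₀ c.2 = V)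
    (R := fun n c d => (∃ t : X ≃ₜ X, (∀ x, CoverNear c.2 x (t x)) ∧ ∀ x, d.1 x = c.1 (t x)) ∧
      StarRefines d.2 c.2 ∧ ∀ u ∈ d.2, u.Nonempty →
        (∀ x ∈ u, ∀ y ∈ u, dist (d.1 x) (d.1 y) ≤ (1 / 2) ^ n) ∧
        ∃ P ∈ D.pieces, u ⊆ Metric.thickening ((1 / 2) ^ n) P)
    (a₀ := (Homeomorph.refl X, 𝒢₃)) ⟨fun _ _ => rfl, hg3, hU3⟩
    (by
      rintro n ⟨a, 𝒰⟩ ⟨ha, h𝒰, h𝒰V⟩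
      obtain ⟨t, 𝒰', h1, h2, h3, h4, h5, h6⟩ := shrinking_step hv hs hV hVs a h𝒰 h𝒰V n
      exact ⟨(t.trans a, 𝒰'), ⟨fun x hx => by simp [h1 x hx, ha x hx], h3, h4⟩,
        ⟨t, h2, fun x => rfl⟩, h5, h6⟩)
  choose t htn hta using fun n => (hsR n).1
  have hstar : ∀ n, StarRefines (s (n + 1)).2 (s n).2 := fun n => (hsR n).2.1
  have hdiam : ∀ n, ∀ u ∈ (s (n + 1)).2, ∀ x ∈ u, ∀ y ∈ u,
      dist ((s (n + 1)).1 x) ((s (n + 1)).1 y) ≤ (1 / 2) ^ n := fun n u hu x hx y hy =>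
    ((hsR n).2.2 u hu ⟨x, hx⟩).1 x hx y hy
  have haV : ∀ n, ∀ x ∈ V, (s n).1 x ∈ V := fun n x hx =>
    (s n).1.mem_of_eq_self_off (hsP n).1 hx
  have hpiece : ∀ n, ∀ x ∈ V, ∃ u ∈ (s n).2, (D.q x).1 ⊆ u := by
    intro n x hx
    obtain ⟨u, hu, hxu⟩ := (hsP n).2.2.symm ▸ hx
    exact ⟨u, hu, ((hsP n).2.1 u hu).2.q_mem hxu⟩
  -- `s (m + 1 + j)` differs from `s (m + 1)` by a map close to the identity
  have htail : ∀ j m x, ∃ y, (s (m + 1 + j)).1 x = (s (m + 1)).1 y ∧ CoverNear (s m).2 x y := by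
    intro j
    induction j with
    | zero => exact fun m x => ⟨x, rfl, CoverNear.refl _ _⟩
    | succ j ih =>
      intro m x
      obtain ⟨y, hy, hxy⟩ := ih (m + 1) x
      refine ⟨t (m + 1) y, ?_, (hstar m).trans hxy (htn _ _)⟩
      rw [show m + 1 + (j + 1) = m + 1 + 1 + j by ring, hy, hta]
  have hclose : ∀ j x, CoverNear 𝒢₂ x ((s (j + 1)).1 x) := by
    intro j x
    obtain ⟨y, hy, hxy⟩ := htail j 0 x
    have h1 := htn 0 y
    rw [hs0] at h1 hxy
    rw [show j + 1 = 0 + 1 + j by ring, hy, hta, hs0]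
    exact StarRefines.trans hg3s hxy h1
  obtain ⟨a, hac, hat, had⟩ := exists_continuous_limit (f := fun n => ⇑(s (n + 1)).1)
    (fun n => (s (n + 1)).1.continuous) (by
      intro n x
      rw [hta (n + 1)]
      rcases htn (n + 1) x with h | ⟨u, hu, hx, hy⟩
      · rw [← h, dist_self]
        positivity
      · exact hdiam n u hu _ hx _ hy)
  have hpow : ∀ ε > (0 : ℝ), ∃ n : ℕ, (1 / 2 : ℝ) ^ n < ε := fun ε hε =>
    exists_pow_lt_of_lt_one hε (by norm_num)
  have haid : ∀ x ∉ V, a x = x := by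
    intro x hx
    refine tendsto_nhds_unique (hat x) ?_
    simp only [(hsP _).1 x hx]
    exact tendsto_const_nhds
  have haV' : ∀ x ∈ V, a x ∈ V := by
    intro x hx
    by_contra hn
    obtain ⟨N, hN, h⟩ := hE _ hn {x}ᶜ (isOpen_compl_singleton.mem_nhds
      fun h : a x = x => hn (by rwa [h]))
    obtain ⟨n, hnN⟩ := ((hat x).eventually_mem hN).exists
    obtain ⟨g, hg, hxg, hyg⟩ := (StarRefines.mono hg2s (hclose n x)).exists_mem (hU1 ▸ hx)
    exact h g hg ⟨_, hyg, hnN⟩ hxg rfl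
  have hanear : ∀ x ∈ V, ∃ g ∈ 𝒢₁, x ∈ g ∧ a x ∈ g := by
    intro x hx
    obtain ⟨g, hg, hag⟩ := hU2.symm ▸ haV' x hx
    obtain ⟨n, hn⟩ := ((hat x).eventually_mem ((hg2 g hg).1.mem_nhds hag)).exists
    exact (StarRefines.trans hg2s (hclose n x) (Or.inr ⟨g, hg, hn, hag⟩)).exists_mem (hU1 ▸ hx)
  have hkey : ∀ z ∈ V, ∀ m, ∃ u ∈ (s m).2, ∃ N ∈ 𝓝 z, ∀ x, a x ∈ N → x ∈ u := by
    intro z hz m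
    obtain ⟨w, rfl⟩ := (s (m + 3)).1.surjective z
    have hw : w ∈ V := by
      by_contra hw
      rw [(hsP _).1 w hw] at hz
      exact hw hz
    obtain ⟨u₀, hu₀, hwu₀⟩ := (hsP (m + 1)).2.2.symm ▸ hw
    obtain ⟨u₁, hu₁, hwu₁⟩ := (hsP (m + 2)).2.2.symm ▸ hw
    obtain ⟨u, hu, hst⟩ := hstar m u₀ hu₀ ⟨w, hwu₀⟩
    refine ⟨u, hu, (s (m + 3)).1 '' u₁, ((s (m + 3)).1.isOpenMap _
      ((hsP (m + 2)).2.1 u₁ hu₁).1).mem_nhds ⟨w, hwu₁, rfl⟩, fun x hx => ?_⟩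
    have hNo := ((s (m + 3)).1.isOpenMap _ ((hsP (m + 2)).2.1 u₁ hu₁).1).mem_nhds hx
    obtain ⟨n, hn, hnm⟩ := (((hat x).eventually_mem hNo).and
      (Filter.eventually_ge_atTop (m + 2))).exists
    obtain ⟨j, rfl⟩ := Nat.exists_eq_add_of_le hnm
    obtain ⟨y, hy, hxy⟩ := htail j (m + 2) x
    have hn' : (s (m + 2 + 1 + j)).1 x ∈ (s (m + 3)).1 '' u₁ := by
      rw [show m + 2 + 1 + j = m + 2 + j + 1 by ring]
      exact hn
    rw [hy] at hn'
    obtain ⟨y', hy', hyy'⟩ := hn'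
    obtain rfl : y' = y := (s (m + 3)).1.injective hyy'
    have hxw : CoverNear (s (m + 1)).2 x w :=
      (hstar (m + 1)).trans hxy (Or.inr ⟨u₁, hu₁, hy', hwu₁⟩)
    rcases hxw with rfl | ⟨g, hg, hxg, hwg⟩
    · exact hst u₀ hu₀ ⟨x, hwu₀, hwu₀⟩ hwu₀
    · exact hst g hg ⟨w, hwg, hwu₀⟩ hxg
  have hthick : ∀ z ∈ V, ∀ ε > 0, ∃ P ∈ D.pieces, ∃ N ∈ 𝓝 z, ∀ x, a x ∈ N →
      x ∈ Metric.thickening ε P := by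
    intro z hz ε hε
    obtain ⟨m, hm⟩ := hpow ε hε
    obtain ⟨u, hu, N, hN, h⟩ := hkey z hz (m + 1)
    by_cases hne : u.Nonempty
    · obtain ⟨-, P, hP, huP⟩ := (hsR m).2.2 u hu hne
      exact ⟨P, hP, N, hN, fun x hx => Metric.thickening_mono hm.le _ (huP (h x hx))⟩
    · refine ⟨_, D.q_mem_pieces z, N, hN, fun x hx => (hne ⟨x, h x hx⟩).elim⟩
  have hclosed : IsClosedMap a := by
    intro F hF
    refine isClosed_of_closure_subset fun z hz => ?_
    by_cases hzV : z ∈ V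
    · obtain ⟨l, hl, hlz⟩ := mem_closure_iff_ultrafilter.1 hz
      set k := Ultrafilter.ofComapInfPrincipal hl with hk
      have hkF : F ∈ k := Ultrafilter.ofComapInfPrincipal_mem hl
      have hkm : Filter.Tendsto a k (𝓝 z) := by
        have := Ultrafilter.ofComapInfPrincipal_eq_of_map hl
        change Filter.map a (k : Filter X) ≤ _
        rw [← Ultrafilter.coe_map, this]
        exact hlz
      have hC : Cauchy (k : Filter X) := by
        rw [Metric.cauchy_iff]
        refine ⟨k.neBot, fun ε hε => ?_⟩
        obtain ⟨P, hP, N, hN, h⟩ := hthick z hzV (ε / 4) (by positivity)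
        obtain ⟨c, hcf, hc⟩ := Metric.totallyBounded_iff.1
          (D.isCompact' P hP).totallyBounded (ε / 4) (by positivity)
        have hm : (⋃ y ∈ c, Metric.ball y (ε / 2)) ∈ k := by
          refine Filter.mem_of_superset (hkm hN) fun x hx => ?_
          obtain ⟨p, hp, hxp⟩ := Metric.mem_thickening_iff.1 (h x hx)
          obtain ⟨y, hy, hpy⟩ := mem_iUnion₂.1 (hc hp)
          refine mem_iUnion₂.2 ⟨y, hy, Metric.mem_ball.2 ?_⟩
          have := dist_triangle x p y
          rw [Metric.mem_ball] at hpy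
          linarith
        obtain ⟨y, hy, hyk⟩ := (Ultrafilter.finite_biUnion_mem_iff hcf).1 hm
        refine ⟨_, hyk, fun x hx x' hx' => ?_⟩
        have := dist_triangle_right x x' y
        rw [Metric.mem_ball] at hx hx'
        linarith
      obtain ⟨x, hx⟩ := CompleteSpace.complete hC
      refine ⟨x, ?_, tendsto_nhds_unique ((hac.tendsto x).mono_left hx) hkm⟩
      exact hF.mem_of_frequently_of_tendsto (f := id) (b := (k : Filter X))
        (Filter.Eventually.frequently hkF) hx
    · refine ⟨z, ?_, haid z hzV⟩
      rw [← hF.closure_eq, mem_closure_iff_nhds]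
      intro O hO
      obtain ⟨N, hN, h⟩ := hE z hzV O hO
      obtain ⟨_, ⟨hyN, hyO⟩, x, hxF, rfl⟩ := mem_closure_iff_nhds.1 hz _ (Filter.inter_mem hN hO)
      refine ⟨x, ?_, hxF⟩
      by_cases hx : x ∈ V
      · obtain ⟨g, hg, hxg, hag⟩ := hanear x hx
        exact h g hg ⟨_, hag, hyN⟩ hxg
      · rwa [haid x hx] at hyO
  have hsurj : Function.Surjective a := by
    intro z
    have : z ∈ closure (range a) := by
      rw [Metric.mem_closure_range_iff]
      intro ε hε
      obtain ⟨n, hn⟩ := hpow (ε / 2) (by positivity)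
      obtain ⟨x, rfl⟩ := (s (n + 1)).1.surjective z
      exact ⟨x, (had n x).trans_lt (by linarith)⟩
    rwa [hclosed.isClosed_range.closure_eq] at this
  have hfib : ∀ x y, D.q x = D.q y → a x = a y := by
    intro x y hxy
    by_cases hy : y ∈ V
    · have hd : ∀ n, dist (a x) (a y) ≤ 5 * (1 / 2 : ℝ) ^ n := by
        intro n
        obtain ⟨u, hu, hyu⟩ := hpiece (n + 1) y hy
        have h1 := hdiam n u hu x (hyu (q_eq_iff.1 hxy)) y (hyu (D.mem_q y))
        have h2 := had n x
        have h3 := had n y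
        have h4 := dist_triangle4 (a x) ((s (n + 1)).1 x) ((s (n + 1)).1 y) (a y)
        rw [dist_comm] at h2
        linarith
      refine dist_le_zero.1 (le_of_forall_pos_lt_add fun ε hε => ?_)
      obtain ⟨n, hn⟩ := hpow (ε / 5) (by positivity)
      have := hd n
      linarith
    · by_cases hss : (D.q y).1.Subsingleton
      · rw [hss (D.mem_q y) (q_eq_iff.1 hxy)]
      · exact (hy (hVn _ (D.q_mem_pieces y) hss (D.mem_q y))).elim
  have hinj : ∀ x y, a x = a y → D.q x = D.q y := by
    intro x y hxy
    by_cases hx : x ∈ V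
    · have hz := haV' x hx
      by_contra hne
      have hdis : Disjoint (D.q x).1 (D.q y).1 := D.disjoint' _ (D.q_mem_pieces x) _
        (D.q_mem_pieces y) fun h => hne (Subtype.ext h)
      obtain ⟨O, O', hO, hO', hxO, hyO, hOO⟩ := SeparatedNhds.of_isCompact_isCompact
        (D.isCompact' _ (D.q_mem_pieces x)) (D.isCompact' _ (D.q_mem_pieces y)) hdis
      have hxc : x ∈ D.core O := hxO
      have hyc : y ∈ D.core O' := hyO
      obtain ⟨ε, hε, hεO⟩ := Metric.isOpen_iff.1 (hv.isOpen_core hO) x hxc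
      obtain ⟨ε', hε', hεO'⟩ := Metric.isOpen_iff.1 (hv.isOpen_core hO') y hyc
      obtain ⟨P, hP, N, hN, h⟩ := hthick _ hz (min ε ε') (by positivity)
      obtain ⟨p, hp, hxp⟩ := Metric.mem_thickening_iff.1 (h x (mem_of_mem_nhds hN))
      obtain ⟨p', hp', hyp⟩ := Metric.mem_thickening_iff.1 (h y (hxy ▸ mem_of_mem_nhds hN))
      have h1 : P ⊆ D.core O := core_saturated P hP ⟨p, hp, hεO (by
        rw [Metric.mem_ball, dist_comm]
        exact hxp.trans_le (min_le_left _ _))⟩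
      have h2 : P ⊆ D.core O' := core_saturated P hP ⟨p', hp', hεO' (by
        rw [Metric.mem_ball, dist_comm]
        exact hyp.trans_le (min_le_right _ _))⟩
      exact Set.disjoint_left.1 hOO (core_subset (h1 hp)) (core_subset (h2 hp))
    · have hy : y ∉ V := fun hy => hx (by
        rw [← haid x hx, hxy]
        exact haV' y hy)
      rw [← haid x hx, ← haid y hy, hxy]
  let g : D.Space → X := fun P => a (D.nonempty' P.1 P.2).choose
  have hg : ∀ x, g (D.q x) = a x := fun x =>
    hfib _ _ (q_eq_iff.2 (D.nonempty' _ (D.q_mem_pieces x)).choose_spec)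
  have hgc : Continuous g := continuous_iff.2 (hac.congr fun x => (hg x).symm)
  have hgb : Function.Bijective g := by
    constructor
    · intro P Q hPQ
      obtain ⟨x, rfl⟩ := q_surjective P
      obtain ⟨y, rfl⟩ := q_surjective Q
      rw [hg, hg] at hPQ
      exact hinj x y hPQ
    · intro z
      obtain ⟨x, rfl⟩ := hsurj z
      exact ⟨_, hg x⟩
  have hgcl : IsClosedMap g := by
    intro C hC
    have : g '' C = a '' (D.q ⁻¹' C) := by
      ext z
      constructor
      · rintro ⟨P, hP, rfl⟩
        obtain ⟨x, rfl⟩ := q_surjective P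
        exact ⟨x, hP, (hg x).symm⟩
      · rintro ⟨x, hx, rfl⟩
        exact ⟨_, hx, hg x⟩
    rw [this]
    exact hclosed _ (hC.preimage continuous_q)
  refine ⟨(Equiv.ofBijective g hgb).toHomeomorphOfContinuousClosed hgc hgcl, fun x hx =>
    (hg x).trans (haid x hx), fun x hx => ?_⟩
  change g (D.q x) ∈ V ∧ ∃ g' ∈ 𝒢, x ∈ g' ∧ g (D.q x) ∈ g'
  rw [hg]
  obtain ⟨g', hg', h1, h2⟩ := hanear x hx
  obtain ⟨-, -, -, g₀, hg₀, hgg⟩ := hg1 g' hg'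
  exact ⟨haV' x hx, g₀, hg₀, hgg h1, hgg h2⟩

end Decomposition

/-! ### Scales of closeness -/

/-- A decreasing sequence of open closeness relations on `V`, degenerating at the complement of
`V` and eventually finer than the metric. -/
structure IsScale {X : Type*} [MetricSpace X] (V : Set X) (E : ℕ → X → X → Prop) (d : ℕ) :
    Prop where
  refl : ∀ n x, E n x x
  symm : ∀ n x y, E n x y → E n y x
  trans₃ : ∀ n x y z w, E (n + 1) x y → E (n + 1) y z → E (n + 1) z w → E n x w
  isOpen : ∀ n, IsOpen {p : X × X | p.1 ∈ V ∧ p.2 ∈ V ∧ E n p.1 p.2}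
  dist_le : ∀ n x y, E (n + d) x y → dist x y ≤ (1 / 2) ^ n
  boundary : ∀ x ∉ V, ∀ O ∈ 𝓝 x, ∃ N ∈ 𝓝 x, ∀ y ∈ N, ∀ z, E 0 y z → z ∈ O

/-- Any two points of `S` are related by `E`. -/
def IsSmall {X : Type*} (E : X → X → Prop) (S : Set X) : Prop := ∀ x ∈ S, ∀ y ∈ S, E x y

lemma IsSmall.subset {X : Type*} {E : X → X → Prop} {S T : Set X} (h : IsSmall E T) (hST : S ⊆ T) :
    IsSmall E S := fun x hx y hy => h x (hST hx) y (hST hy)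

namespace IsScale

variable {X : Type*} [MetricSpace X] {V : Set X} {E : ℕ → X → X → Prop} {d : ℕ}

lemma trans (hE : IsScale V E d) {n : ℕ} {x y z : X} (h : E (n + 1) x y) (h' : E (n + 1) y z) :
    E n x z :=
  hE.trans₃ n x y z z h h' (hE.refl _ _)

lemma mono (hE : IsScale V E d) {m n : ℕ} (hmn : m ≤ n) {x y : X} (h : E n x y) : E m x y := by
  induction n, hmn using Nat.le_induction with
  | base => exact h
  | succ k _ ih => exact ih (hE.trans h (hE.refl _ _))

lemma isSmall_mono (hE : IsScale V E d) {m n : ℕ} (hmn : m ≤ n) {S : Set X}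
    (h : IsSmall (E n) S) : IsSmall (E m) S := fun x hx y hy => hE.mono hmn (h x hx y hy)

lemma isSmall_of_subsingleton (hE : IsScale V E d) (n : ℕ) {S : Set X} (h : S.Subsingleton) :
    IsSmall (E n) S := fun _ hx _ hy => h hx hy ▸ hE.refl _ _

lemma eq_of_notMem (hE : IsScale V E d) {n : ℕ} {x y : X} (h : E n x y) (hx : x ∉ V) : x = y := by
  by_contra hne
  obtain ⟨N, hN, hNO⟩ := hE.boundary x hx {y}ᶜ (isOpen_compl_singleton.mem_nhds hne)
  exact hNO x (mem_of_mem_nhds hN) y (hE.mono (Nat.zero_le _) h) rfl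

lemma exists_isSmall_of_isCompact (hE : IsScale V E d) (n : ℕ) {P : Set X} (hP : IsCompact P)
    (hPV : P ⊆ V) (hs : IsSmall (E n) P) : ∃ O, IsOpen O ∧ P ⊆ O ∧ O ⊆ V ∧ IsSmall (E n) O := by
  obtain ⟨u, v, hu, hv, hPu, hPv, huv⟩ := generalized_tube_lemma hP hP (hE.isOpen n)
    (fun p hp => ⟨hPV hp.1, hPV hp.2, hs _ hp.1 _ hp.2⟩)
  exact ⟨u ∩ v, hu.inter hv, subset_inter hPu hPv,
    fun x hx => (huv (mk_mem_prod hx.1 hx.2) : _ ∧ _).1,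
    fun x hx y hy => (huv (mk_mem_prod hx.1 hy.2) : _ ∧ _ ∧ _).2.2⟩

lemma exists_isSmall_nhds (hE : IsScale V E d) (n : ℕ) {x : X} (hx : x ∈ V) :
    ∃ O, IsOpen O ∧ x ∈ O ∧ O ⊆ V ∧ IsSmall (E n) O := by
  obtain ⟨O, hO, hxO, h⟩ := hE.exists_isSmall_of_isCompact n isCompact_singleton
    (singleton_subset_iff.2 hx) (hE.isSmall_of_subsingleton n subsingleton_singleton)
  exact ⟨O, hO, singleton_subset_iff.1 hxO, h⟩

lemma exists_isSmall_preimage (hE : IsScale V E d) (n : ℕ) (F : X ≃ₜ X)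
    (hF : ∀ x ∉ V, F x = x) {P : Set X} (hP : IsCompact P) (hPV : P ⊆ V)
    (hs : IsSmall (E n) (F '' P)) : ∃ O, IsOpen O ∧ P ⊆ O ∧ O ⊆ V ∧ IsSmall (E n) (F '' O) := by
  obtain ⟨O, hO, hPO, hOV, hOs⟩ := hE.exists_isSmall_of_isCompact n (hP.image F.continuous)
    (by
      rintro _ ⟨x, hx, rfl⟩
      exact F.mem_of_eq_self_off hF (hPV hx)) hs
  refine ⟨F ⁻¹' O ∩ V, ?_, ?_, fun x hx => hx.2, ?_⟩
  · have hVo : IsOpen V := by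
      rw [isOpen_iff_mem_nhds]
      intro x hx
      obtain ⟨W, hW, hxW, hWV, -⟩ := hE.exists_isSmall_nhds 0 hx
      exact Filter.mem_of_superset (hW.mem_nhds hxW) hWV
    exact (hO.preimage F.continuous).inter hVo
  · intro x hx
    exact ⟨hPO ⟨x, hx, rfl⟩, hPV hx⟩
  · refine hOs.subset ?_
    rintro _ ⟨x, hx, rfl⟩
    exact hx.1

end IsScale

/-! ### Partial matchings of decompositions -/

/-- Standing properties of the decompositions to be matched. -/
structure Decomposition.IsMatchable {X : Type*} [MetricSpace X] (D : Decomposition X)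
    (𝒦 : Set (Set X)) (V : Set X) : Prop where
  vanishing : D.Vanishing
  shrinkable : D.AmbientShrinkable
  mem : ∀ P ∈ D.pieces, ¬ P.Subsingleton → P ∈ 𝒦
  subset : ∀ P ∈ D.pieces, ¬ P.Subsingleton → P ⊆ V
  dense : ∀ O, IsOpen O → ∀ P ∈ D.pieces, P ⊆ O → ∃ Q ∈ D.pieces, ¬ Q.Subsingleton ∧ Q ⊆ O

/-- `F` matches the pieces of `A` from `C` with pieces of `B`, all other pieces being small. -/
structure IsMatching {X : Type*} [MetricSpace X] (A B : Decomposition X) (V : Set X)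
    (E : ℕ → X → X → Prop) (F : X ≃ₜ X) (C : Set (Set X)) (a₁ a₂ b₁ b₂ : ℕ) : Prop where
  eq_self : ∀ x ∉ V, F x = x
  subset : C ⊆ A.pieces
  image_mem : ∀ K ∈ C, F '' K ∈ B.pieces
  locallyFinite : ∀ x ∈ V, ∃ N ∈ 𝓝 x, {K ∈ C | (K ∩ N).Nonempty}.Finite
  small_left : ∀ K ∈ A.pieces, K ∉ C → IsSmall (E a₁) K
  small_image : ∀ K ∈ A.pieces, K ∉ C → IsSmall (E a₂) (F '' K)
  small_right : ∀ L ∈ B.pieces, F.symm '' L ∉ C → IsSmall (E b₁) L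
  small_preimage : ∀ L ∈ B.pieces, F.symm '' L ∉ C → IsSmall (E b₂) (F.symm '' L)

/-- The matching `(F', C')` extends `(F, C)` and is `E`-close to it. -/
structure IsCloseExtension {X : Type*} [TopologicalSpace X] (E : X → X → Prop) (F : X ≃ₜ X)
    (C : Set (Set X)) (F' : X ≃ₜ X) (C' : Set (Set X)) : Prop where
  subset : C ⊆ C'
  eqOn : ∀ K ∈ C, ∀ x ∈ K, F' x = F x
  near : ∀ x, E (F x) (F' x)
  near_symm : ∀ y, E (F.symm y) (F'.symm y)

section Matching

variable {X : Type*} [MetricSpace X] {V : Set X} {E : ℕ → X → X → Prop} {d : ℕ}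
  {A B : Decomposition X} {F F' F'' : X ≃ₜ X} {C C' C'' : Set (Set X)} {a₁ a₂ b₁ b₂ m n : ℕ}

lemma IsCloseExtension.mono (hE : IsScale V E d) (hmn : m ≤ n)
    (h : IsCloseExtension (E n) F C F' C') : IsCloseExtension (E m) F C F' C' :=
  ⟨h.subset, h.eqOn, fun x => hE.mono hmn (h.near x), fun x => hE.mono hmn (h.near_symm x)⟩

lemma IsCloseExtension.trans (hE : IsScale V E d) (h : IsCloseExtension (E (n + 1)) F C F' C')
    (h' : IsCloseExtension (E (n + 1)) F' C' F'' C'') : IsCloseExtension (E n) F C F'' C'' :=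
  ⟨h.subset.trans h'.subset, fun K hK x hx => (h'.eqOn K (h.subset hK) x hx).trans (h.eqOn K hK x hx),
    fun x => hE.trans (h.near x) (h'.near x), fun x => hE.trans (h.near_symm x) (h'.near_symm x)⟩

lemma image_image_symm (F : X ≃ₜ X) (C : Set (Set X)) :
    (fun K => F.symm '' K) '' ((fun K => F '' K) '' C) = C := by
  rw [image_image]
  simp only [← image_comp, Homeomorph.symm_comp_self, image_id, image_id']

lemma mem_image_image_iff (F : X ≃ₜ X) {L : Set X} :
    L ∈ (fun K => F '' K) '' C ↔ F.symm '' L ∈ C := by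
  constructor
  · rintro ⟨K, hK, rfl⟩
    simpa only [← image_comp, Homeomorph.symm_comp_self, image_id] using hK
  · intro h
    exact ⟨_, h, by simp only [← image_comp, Homeomorph.self_comp_symm, image_id]⟩

lemma IsCloseExtension.swap {R : X → X → Prop} (h : IsCloseExtension R F C F' C') :
    IsCloseExtension R F.symm ((fun K => F '' K) '' C) F'.symm ((fun K => F' '' K) '' C') where
  subset := by
    rintro _ ⟨K, hK, rfl⟩
    exact ⟨K, h.subset hK, image_congr fun x hx => h.eqOn K hK x hx⟩
  eqOn := by
    rintro _ ⟨K, hK, rfl⟩ _ ⟨x, hx, rfl⟩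
    rw [Homeomorph.symm_apply_apply, Homeomorph.symm_apply_eq, h.eqOn K hK x hx]
  near := h.near_symm
  near_symm := h.near

lemma IsMatching.swap (h : IsMatching A B V E F C a₁ a₂ b₁ b₂) :
    IsMatching B A V E F.symm ((fun K => F '' K) '' C) b₁ b₂ a₁ a₂ where
  eq_self := F.symm_eq_self_off h.eq_self
  subset := by
    rintro _ ⟨K, hK, rfl⟩
    exact h.image_mem K hK
  image_mem := by
    rintro _ ⟨K, hK, rfl⟩
    simpa only [← image_comp, Homeomorph.symm_comp_self, image_id] using h.subset hK
  locallyFinite := by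
    intro y hy
    obtain ⟨N, hN, hf⟩ := h.locallyFinite (F.symm y)
      (F.symm.mem_of_eq_self_off (F.symm_eq_self_off h.eq_self) hy)
    refine ⟨F.symm ⁻¹' N, F.symm.continuous.continuousAt hN, (hf.image fun K => F '' K).subset ?_⟩
    rintro _ ⟨⟨K, hK, rfl⟩, _, ⟨x, hx, rfl⟩, hxN⟩
    rw [mem_preimage, Homeomorph.symm_apply_apply] at hxN
    exact ⟨K, ⟨hK, x, hx, hxN⟩, rfl⟩
  small_left L hL hLC := h.small_right L hL fun h' => hLC ((mem_image_image_iff F).2 h')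
  small_image L hL hLC := h.small_preimage L hL fun h' => hLC ((mem_image_image_iff F).2 h')
  small_right K hK hKC := h.small_left K hK fun h' => hKC ⟨K, h', rfl⟩
  small_preimage K hK hKC := h.small_image K hK fun h' => hKC ⟨K, h', rfl⟩

lemma IsMatching.mono (hE : IsScale V E d) (h : IsMatching A B V E F C a₁ a₂ b₁ b₂)
    {a₁' a₂' b₁' b₂' : ℕ} (h₁ : a₁' ≤ a₁) (h₂ : a₂' ≤ a₂) (h₃ : b₁' ≤ b₁) (h₄ : b₂' ≤ b₂) :
    IsMatching A B V E F C a₁' a₂' b₁' b₂' where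
  eq_self := h.eq_self
  subset := h.subset
  image_mem := h.image_mem
  locallyFinite := h.locallyFinite
  small_left K hK hKC := hE.isSmall_mono h₁ (h.small_left K hK hKC)
  small_image K hK hKC := hE.isSmall_mono h₂ (h.small_image K hK hKC)
  small_right K hK hKC := hE.isSmall_mono h₃ (h.small_right K hK hKC)
  small_preimage K hK hKC := hE.isSmall_mono h₄ (h.small_preimage K hK hKC)

/-- The part of `V` outside of the matched pieces. -/
lemma IsMatching.isOpen_diff (hV : IsOpen V) (h : IsMatching A B V E F C a₁ a₂ b₁ b₂) :
    IsOpen (V \ ⋃₀ C) := by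
  rw [isOpen_iff_mem_nhds]
  rintro x ⟨hx, hxC⟩
  obtain ⟨N, hN, hf⟩ := h.locallyFinite x hx
  have hcl : IsClosed (⋃₀ {K ∈ C | (K ∩ N).Nonempty}) :=
    sUnion_eq_biUnion ▸ hf.isClosed_biUnion fun K hK => (A.isCompact' K (h.subset hK.1)).isClosed
  filter_upwards [hN, hV.mem_nhds hx, hcl.isOpen_compl.mem_nhds
    fun ⟨K, hK, hxK⟩ => hxC ⟨K, hK.1, hxK⟩] with y hyN hyV hy
  exact ⟨hyV, fun ⟨K, hK, hyK⟩ => hy ⟨K, ⟨hK, y, hyK, hyN⟩, hyK⟩⟩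

lemma IsMatching.saturated_diff (hVs : A.Saturated V)
    (h : IsMatching A B V E F C a₁ a₂ b₁ b₂) : A.Saturated (V \ ⋃₀ C) := by
  rintro P hP ⟨x, hxP, hxV, hxC⟩ y hy
  refine ⟨hVs P hP ⟨x, hxP, hxV⟩ hy, ?_⟩
  rintro ⟨K, hK, hyK⟩
  exact hxC ⟨K, hK, Decomposition.eq_of_mem hP (h.subset hK) hy hyK ▸ hxP⟩

lemma IsMatching.notMem_of_subset_diff {K : Set X} (hK : K ∈ A.pieces) (h : K ⊆ V \ ⋃₀ C) :
    K ∉ C := by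
  intro hKC
  obtain ⟨x, hx⟩ := A.nonempty' K hK
  exact (h hx).2 ⟨K, hKC, hx⟩

lemma IsMatching.subset_diff_or_subsingleton (hVn : ∀ P ∈ A.pieces, ¬ P.Subsingleton → P ⊆ V)
    (h : IsMatching A B V E F C a₁ a₂ b₁ b₂) {K : Set X} (hK : K ∈ A.pieces) (hKC : K ∉ C) :
    K ⊆ V \ ⋃₀ C ∨ K.Subsingleton := by
  by_cases hs : K.Subsingleton
  · exact Or.inr hs
  · refine Or.inl fun x hx => ⟨hVn K hK hs hx, ?_⟩
    rintro ⟨K', hK', hxK'⟩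
    exact hKC (Decomposition.eq_of_mem hK (h.subset hK') hx hxK' ▸ hK')

/-- Shrinking the images of the unmatched pieces. -/
lemma IsMatching.shrink {𝒦 : Set (Set X)} (hE : IsScale V E d) (hV : IsOpen V)
    (hA : A.IsMatchable 𝒦 V) (h : IsMatching A B V E F C a₁ a₂ b₁ b₂) (m : ℕ)
    (ha : n + 1 ≤ a₁) (hb : n + 1 ≤ b₂) :
    ∃ F', IsMatching A B V E F' C a₁ m b₁ n ∧ IsCloseExtension (E (min a₁ a₂)) F C F' C := by
  have hVs : A.Saturated V := Decomposition.saturated_of_nondeg_subset hA.subset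
  obtain ⟨s, hs1, hs2, hs3⟩ := hA.shrinkable _ (h.isOpen_diff hV) (h.saturated_diff hVs)
    {g | IsOpen g ∧ IsSmall (E a₁) g ∧ IsSmall (E a₂) (F '' g)} (fun g hg => hg.1)
    (by
      intro P hP hPU
      have hPC := IsMatching.notMem_of_subset_diff hP hPU
      have hPV := hPU.trans sdiff_subset
      obtain ⟨O, hO, hPO, -, hOs⟩ := hE.exists_isSmall_of_isCompact a₁ (A.isCompact' P hP) hPV
        (h.small_left P hP hPC)
      obtain ⟨O', hO', hPO', -, hOs'⟩ := hE.exists_isSmall_preimage a₂ F h.eq_self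
        (A.isCompact' P hP) hPV (h.small_image P hP hPC)
      exact ⟨O ∩ O', ⟨hO.inter hO', hOs.subset inter_subset_left,
        hOs'.subset (image_mono inter_subset_right)⟩, subset_inter hPO hPO'⟩)
    {v | IsOpen v ∧ IsSmall (E m) (F '' v)} (fun v hv => hv.1)
    (by
      intro x hx
      obtain ⟨O, hO, hxO, -, hOs⟩ := hE.exists_isSmall_preimage m F h.eq_self
        (isCompact_singleton (x := x)) (singleton_subset_iff.2 hx.1)
        (hE.isSmall_of_subsingleton m (subsingleton_singleton.image _))
      exact ⟨O, ⟨hO, hOs⟩, hxO rfl⟩)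
  have hsn : ∀ x, E a₁ x (s x) ∧ E a₂ (F x) (F (s x)) := by
    intro x
    by_cases hx : x ∈ V \ ⋃₀ C
    · obtain ⟨g, ⟨-, hg1, hg2⟩, hxg, hsg⟩ := hs2 x hx
      exact ⟨hg1 _ hxg _ hsg, hg2 _ ⟨x, hxg, rfl⟩ _ ⟨_, hsg, rfl⟩⟩
    · rw [hs1 x hx]
      exact ⟨hE.refl _ _, hE.refl _ _⟩
  have hsn' : ∀ x, E a₁ x (s.symm x) := fun x => by
    have := (hsn (s.symm x)).1
    rw [s.apply_symm_apply] at this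
    exact hE.symm _ _ _ this
  have hsC : ∀ K ∈ C, ∀ x ∈ K, s x = x := fun K hK x hx => hs1 x fun hx' => hx'.2 ⟨K, hK, hx⟩
  have hFC : ∀ K ∈ C, (s.trans F) '' K = F '' K := fun K hK =>
    image_congr fun x hx => by rw [Homeomorph.trans_apply, hsC K hK x hx]
  have hnot : ∀ L, (s.trans F).symm '' L ∉ C → F.symm '' L ∉ C := by
    intro L hL hL'
    refine hL ?_
    rw [← mem_image_image_iff] at hL' ⊢
    obtain ⟨K, hK, rfl⟩ := hL'
    exact ⟨K, hK, hFC K hK⟩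
  refine ⟨s.trans F, ⟨?_, h.subset, ?_, h.locallyFinite, h.small_left, ?_, ?_, ?_⟩,
    ⟨Subset.rfl, ?_, ?_, ?_⟩⟩
  · intro x hx
    rw [Homeomorph.trans_apply, hs1 x fun hx' => hx hx'.1, h.eq_self x hx]
  · intro K hK
    rw [hFC K hK]
    exact h.image_mem K hK
  · intro K hK hKC
    rcases h.subset_diff_or_subsingleton hA.subset hK hKC with hKU | hKs
    · obtain ⟨v, ⟨-, hv⟩, hKv⟩ := hs3 K hK hKU
      refine hv.subset ?_
      rintro _ ⟨x, hx, rfl⟩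
      exact ⟨_, hKv ⟨x, hx, rfl⟩, rfl⟩
    · exact hE.isSmall_of_subsingleton m (hKs.image _)
  · exact fun L hL hLC => h.small_right L hL (hnot L hLC)
  · rintro L hL hLC _ ⟨x, hx, rfl⟩ _ ⟨y, hy, rfl⟩
    have h1 := h.small_preimage L hL (hnot L hLC) _ ⟨x, hx, rfl⟩ _ ⟨y, hy, rfl⟩
    exact hE.trans₃ n _ _ _ _ (hE.symm _ _ _ (hE.mono ha (hsn' _))) (hE.mono hb h1)
      (hE.mono ha (hsn' _))
  · intro K hK x hx
    rw [Homeomorph.trans_apply, hsC K hK x hx]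
  · exact fun x => hE.mono (min_le_right _ _) (hsn x).2
  · exact fun y => hE.mono (min_le_left _ _) (hsn' _)

end Matching

/-! ### Matching large pieces -/

lemma exists_discrete_expansion {X : Type*} [MetricSpace X] {ι : Type*} {V : Set X}
    {K Q : ι → Set X} (hQ : ∀ i, IsOpen (Q i)) (hKQ : ∀ i, K i ⊆ Q i)
    (hKV : ∀ i, K i ⊆ V) (hV : IsOpen V) (hd : ∀ x ∈ V, ∃ N ∈ 𝓝 x, ∀ i j, (K i ∩ N).Nonempty →
      (K j ∩ N).Nonempty → i = j) :
    ∃ O : ι → Set X, (∀ i, IsOpen (O i)) ∧ (∀ i, K i ⊆ O i) ∧ (∀ i, O i ⊆ Q i) ∧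
      ∀ x ∈ V, ∃ N ∈ 𝓝 x, ∀ i j, (O i ∩ N).Nonempty → (O j ∩ N).Nonempty → i = j := by
  obtain ⟨𝒢, hg, hU, hs⟩ := exists_open_star_refinement
    {w : Set X | IsOpen w ∧ w ⊆ V ∧ ∀ i j, (K i ∩ w).Nonempty → (K j ∩ w).Nonempty → i = j}
    fun w hw => hw.1
  have hVG : V ⊆ ⋃₀ 𝒢 := by
    intro x hx
    obtain ⟨N, hN, h⟩ := hd x hx
    rw [hU]
    exact ⟨interior N ∩ V, ⟨isOpen_interior.inter hV, inter_subset_right, fun i j hi hj =>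
      h i j (hi.mono (inter_subset_inter_right _ (inter_subset_left.trans interior_subset)))
        (hj.mono (inter_subset_inter_right _ (inter_subset_left.trans interior_subset)))⟩,
      mem_interior_iff_mem_nhds.2 hN, hx⟩
  refine ⟨fun i => ⋃₀ {g ∈ 𝒢 | (g ∩ K i).Nonempty} ∩ Q i, fun i => (isOpen_sUnion fun g hgi =>
    hg g hgi.1).inter (hQ i), ?_, fun i => inter_subset_right, ?_⟩
  · intro i x hx
    obtain ⟨g, hgG, hxg⟩ := hVG (hKV i hx)
    exact ⟨⟨g, ⟨hgG, x, hxg, hx⟩, hxg⟩, hKQ i hx⟩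
  · intro x hx
    obtain ⟨g₀, hg₀, hxg₀⟩ := hVG hx
    obtain ⟨w, ⟨-, -, hw⟩, hst⟩ := hs g₀ hg₀ ⟨x, hxg₀⟩
    have key : ∀ i, (⋃₀ {g ∈ 𝒢 | (g ∩ K i).Nonempty} ∩ Q i ∩ g₀).Nonempty →
        (K i ∩ w).Nonempty := by
      rintro i ⟨y, ⟨⟨g, ⟨hgG, z, hzg, hzK⟩, hyg⟩, -⟩, hyg₀⟩
      exact ⟨z, hzK, hst g hgG ⟨y, hyg, hyg₀⟩ hzg⟩
    exact ⟨g₀, (hg g₀ hg₀).mem_nhds hxg₀, fun i j hi hj => hw i j (key i hi) (key j hj)⟩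

/-- A member of a tame family can be moved into an open set in which members of the family can be
shifted onto each other. -/
lemma IsTameFamily.exists_shift {X : Type*} [TopologicalSpace X] {𝒦 : Set (Set X)}
    (h𝒦 : IsTameFamily 𝒦) {M O : Set X} (hM : M ∈ 𝒦) (hO : IsOpen O) (hMO : M ⊆ O) :
    ∃ (r : X ≃ₜ X) (T : Set X), IsOpen T ∧ T ⊆ O ∧ (∀ x ∉ O, r x = x) ∧ r '' M ⊆ T ∧
      ∀ P ∈ 𝒦, P ⊆ T → ∃ h : X ≃ₜ X, (∀ x ∉ O, h x = x) ∧ h '' M = P := by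
  obtain ⟨-, hamb, hsh, hls, -⟩ := h𝒦
  obtain ⟨r, hr, T, ⟨hT, hTO, hTs⟩, hrT⟩ := hsh M hM O hO hMO
    {v | IsOpen v ∧ v ⊆ O ∧ ∀ P ∈ 𝒦, ∀ Q ∈ 𝒦, P ⊆ v → Q ⊆ v →
      ∃ h : X ≃ₜ X, h '' P = Q ∧ ∀ y ∉ O, h y = y} (fun v hv => ⟨hv.1, hv.2.1⟩) (by
    intro x hx
    obtain ⟨U, hU, hUO, h⟩ := hls x O (hO.mem_nhds hx)
    exact ⟨interior U, ⟨isOpen_interior, interior_subset.trans hUO, fun P hP Q hQ hPU hQU =>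
      h P hP Q hQ (hPU.trans interior_subset) (hQU.trans interior_subset)⟩,
      mem_interior_iff_mem_nhds.2 hU⟩)
  refine ⟨r, T, hT, hTO, hr, hrT, fun P hP hPT => ?_⟩
  obtain ⟨h, hh, hid⟩ := hTs _ (hamb r M hM) P hP hrT hPT
  refine ⟨r.trans h, fun x hx => ?_, ?_⟩
  · rw [Homeomorph.trans_apply, hr x hx, hid x hx]
  · rw [show ⇑(r.trans h) = ⇑h ∘ ⇑r from rfl, image_comp, hh]

section Matching

variable {X : Type*} [MetricSpace X] {V : Set X} {E : ℕ → X → X → Prop} {d : ℕ}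
  {A B : Decomposition X} {F : X ≃ₜ X} {C : Set (Set X)} {a₁ a₂ b₁ b₂ m n : ℕ}

/-- Pieces that are not small form a discrete family in `V`. -/
lemma Decomposition.Vanishing.discrete_of_not_isSmall (hE : IsScale V E d) (hV : IsOpen V)
    (hv : A.Vanishing) (m : ℕ) {x : X} (hx : x ∈ V) :
    ∃ N ∈ 𝓝 x, ∀ K ∈ A.pieces, ¬ IsSmall (E m) K → ∀ L ∈ A.pieces, ¬ IsSmall (E m) L →
      (K ∩ N).Nonempty → (L ∩ N).Nonempty → K = L := by
  obtain ⟨W, hxW, hWc, hWV⟩ := exists_mem_nhds_isClosed_subset (hV.mem_nhds hx)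
  obtain ⟨N, hN, h⟩ := hv ({O | IsOpen O ∧ IsSmall (E m) O} ∪ {Wᶜ}) (by
    rintro u (hu | rfl)
    · exact hu.1
    · exact hWc.isOpen_compl) (by
    refine eq_univ_of_forall fun y => ?_
    by_cases hy : y ∈ W
    · obtain ⟨O, hO, hyO, -, hOs⟩ := hE.exists_isSmall_nhds m (hWV hy)
      exact ⟨O, Or.inl ⟨hO, hOs⟩, hyO⟩
    · exact ⟨Wᶜ, Or.inr rfl, hy⟩) x
  have bad : ∀ K, ¬ IsSmall (E m) K → (K ∩ (N ∩ W)).Nonempty →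
      ∀ u ∈ {O | IsOpen O ∧ IsSmall (E m) O} ∪ {Wᶜ}, ¬ K ⊆ u := by
    rintro K hK ⟨y, hyK, -, hyW⟩ u (hu | rfl) hKu
    · exact hK (hu.2.subset hKu)
    · exact hKu hyK hyW
  refine ⟨N ∩ W, Filter.inter_mem hN hxW, fun K hK hKs L hL hLs hKN hLN => ?_⟩
  exact h K hK (bad K hKs hKN) L hL (bad L hLs hLN)
    (hKN.mono fun y hy => ⟨hy.2.1, hy.1⟩) (hLN.mono fun y hy => ⟨hy.2.1, hy.1⟩)

/-- Matching all pieces of `A` that are not small. -/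
lemma IsMatching.exists_match {𝒦 : Set (Set X)} (h𝒦 : IsTameFamily 𝒦) (hE : IsScale V E d)
    (hV : IsOpen V) (hA : A.IsMatchable 𝒦 V) (hB : B.IsMatchable 𝒦 V)
    (h : IsMatching A B V E F C a₁ a₂ b₁ b₂) (m : ℕ) (ha₁ : n + 2 ≤ a₁) (ha₂ : n + 2 ≤ a₂)
    (hb₁ : n + 2 ≤ b₁) (hb₂ : n + 2 ≤ b₂) :
    ∃ F' C', IsMatching A B V E F' C' m n b₁ n ∧ IsCloseExtension (E (n + 1)) F C F' C' := by
  have hVs : B.Saturated V := Decomposition.saturated_of_nondeg_subset hB.subset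
  have hsw := h.swap
  set FC : Set (Set X) := (fun K => F '' K) '' C with hFC
  have hU : IsOpen (V \ ⋃₀ FC) := hsw.isOpen_diff hV
  have hUs : B.Saturated (V \ ⋃₀ FC) := hsw.saturated_diff hVs
  have hFsymm : ∀ x ∉ V, F.symm x = x := F.symm_eq_self_off h.eq_self
  -- the large pieces and their images
  let ι := {K : Set X // K ∈ A.pieces ∧ K ∉ C ∧ ¬ IsSmall (E m) K}
  have hKn : ∀ K : ι, ¬ K.1.Subsingleton := fun K hs =>
    K.2.2.2 (hE.isSmall_of_subsingleton m hs)
  have hKV : ∀ K : ι, K.1 ⊆ V := fun K => hA.subset _ K.2.1 (hKn K)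
  have hKc : ∀ K : ι, IsCompact K.1 := fun K => A.isCompact' _ K.2.1
  have hFKV : ∀ K : ι, F '' K.1 ⊆ V := by
    rintro K _ ⟨x, hx, rfl⟩
    exact F.mem_of_eq_self_off h.eq_self (hKV K hx)
  have hFKU : ∀ K : ι, F '' K.1 ⊆ V \ ⋃₀ FC := by
    rintro K y ⟨x, hx, rfl⟩
    refine ⟨hFKV K ⟨x, hx, rfl⟩, ?_⟩
    rintro ⟨_, ⟨L, hL, rfl⟩, x', hx', hxx⟩
    obtain rfl := F.injective hxx
    exact K.2.2.1 (Decomposition.eq_of_mem K.2.1 (h.subset hL) hx hx' ▸ hL)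
  have hdisc : ∀ y ∈ V, ∃ N ∈ 𝓝 y, ∀ K L : ι, (F '' K.1 ∩ N).Nonempty →
      (F '' L.1 ∩ N).Nonempty → K = L := by
    intro y hy
    obtain ⟨N, hN, hd⟩ := hA.vanishing.discrete_of_not_isSmall hE hV m
      (F.symm.mem_of_eq_self_off hFsymm hy)
    refine ⟨F.symm ⁻¹' N, F.symm.continuous.continuousAt hN, ?_⟩
    rintro K L ⟨_, ⟨x, hx, rfl⟩, hxN⟩ ⟨_, ⟨x', hx', rfl⟩, hxN'⟩
    rw [mem_preimage, Homeomorph.symm_apply_apply] at hxN hxN'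
    exact Subtype.ext (hd _ K.2.1 K.2.2.2 _ L.2.1 L.2.2.2 ⟨x, hx, hxN⟩ ⟨x', hx', hxN'⟩)
  -- a set is admissible if it is small together with its preimage
  have hadm : ∀ L : Set X, IsCompact L → L ⊆ V → IsSmall (E (n + 2)) L →
      IsSmall (E (n + 2)) (F.symm '' L) → ∃ O, IsOpen O ∧ L ⊆ O ∧ IsSmall (E (n + 2)) O ∧
        IsSmall (E (n + 2)) (F.symm '' O) := by
    intro L hL hLV hs hs'
    obtain ⟨O, hO, hLO, -, hOs⟩ := hE.exists_isSmall_of_isCompact (n + 2) hL hLV hs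
    obtain ⟨O', hO', hLO', -, hOs'⟩ := hE.exists_isSmall_preimage (n + 2) F.symm hFsymm hL hLV hs'
    exact ⟨O ∩ O', hO.inter hO', subset_inter hLO hLO', hOs.subset inter_subset_left,
      hOs'.subset (image_mono inter_subset_right)⟩
  choose Q hQo hKQ hQs hQs' using fun K : ι => hadm (F '' K.1) ((hKc K).image F.continuous)
    (hFKV K) (hE.isSmall_mono ha₂ (h.small_image _ K.2.1 K.2.2.1)) (by
      rw [← image_comp, Homeomorph.symm_comp_self, image_id]
      exact hE.isSmall_mono ha₁ (h.small_left _ K.2.1 K.2.2.1))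
  obtain ⟨O, hOo, hKO, hOQ, hOd⟩ := exists_discrete_expansion (K := fun K : ι => F '' K.1)
    (Q := fun K => Q K ∩ (V \ ⋃₀ FC)) (fun K => (hQo K).inter hU)
    (fun K => subset_inter (hKQ K) (hFKU K)) hFKV hV hdisc
  have hOV : ∀ K, O K ⊆ V := fun K x hx => (hOQ K hx).2.1
  have hOs : ∀ K, IsSmall (E (n + 2)) (O K) := fun K =>
    (hQs K).subset ((hOQ K).trans inter_subset_left)
  have hOs' : ∀ K, IsSmall (E (n + 2)) (F.symm '' O K) := fun K =>
    (hQs' K).subset (image_mono ((hOQ K).trans inter_subset_left))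
  have hOdis : ∀ K L, (O K ∩ O L).Nonempty → K = L := by
    rintro K L ⟨x, hxK, hxL⟩
    obtain ⟨N, hN, hNd⟩ := hOd x (hOV K hxK)
    exact hNd K L ⟨x, hxK, mem_of_mem_nhds hN⟩ ⟨x, hxL, mem_of_mem_nhds hN⟩
  -- targets for the images of the large pieces
  choose r T hTo hTO hr hrT hshift using fun K : ι =>
    h𝒦.exists_shift (h𝒦.2.1 F _ (hA.mem _ K.2.1 (hKn K))) (hOo K) (hKO K)
  have hp : ∀ K : ι, ∃ p, p ∈ T K := fun K => by
    obtain ⟨x, hx⟩ := A.nonempty' _ K.2.1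
    exact ⟨_, hrT K ⟨_, ⟨x, hx, rfl⟩, rfl⟩⟩
  choose p hpT using hp
  obtain ⟨s, hs1, hs2, hs3⟩ := hB.shrinkable _ hU hUs
    {g | IsOpen g ∧ IsSmall (E (n + 2)) g ∧ IsSmall (E (n + 2)) (F.symm '' g)} (fun g hg => hg.1)
    (by
      intro L hL hLU
      have hLC : F.symm '' L ∉ C := fun hLC => by
        refine IsMatching.notMem_of_subset_diff hL hLU ?_
        rwa [hFC, mem_image_image_iff]
      obtain ⟨O', hO', hLO, h1, h2⟩ := hadm L (B.isCompact' L hL) (hLU.trans sdiff_subset)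
        (hE.isSmall_mono hb₁ (h.small_right L hL hLC))
        (hE.isSmall_mono hb₂ (h.small_preimage L hL hLC))
      exact ⟨O', ⟨hO', h1, h2⟩, hLO⟩)
    {v | IsOpen v ∧ ∀ K, p K ∈ v → v ⊆ T K} (fun v hv => hv.1)
    (by
      intro x hx
      by_cases hxp : ∃ K, p K = x
      · obtain ⟨K, rfl⟩ := hxp
        refine ⟨T K, ⟨hTo K, fun L hL => ?_⟩, hpT K⟩
        rw [hOdis K L ⟨p L, hTO K hL, hTO L (hpT L)⟩]
      · obtain ⟨N, hN, hNd⟩ := hOd x hx.1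
        have hf : (p '' {K | (O K ∩ N).Nonempty}).Subsingleton := by
          rintro _ ⟨K, hK, rfl⟩ _ ⟨L, hL, rfl⟩
          rw [hNd K L hK hL]
        refine ⟨interior N \ p '' {K | (O K ∩ N).Nonempty}, ⟨isOpen_interior.sdiff
          hf.finite.isClosed, fun K hK => ?_⟩, mem_interior_iff_mem_nhds.2 hN, ?_⟩
        · exact (hK.2 ⟨K, ⟨p K, hTO K (hpT K), interior_subset hK.1⟩, rfl⟩).elim
        · rintro ⟨K, -, hK⟩
          exact hxp ⟨K, hK⟩)
  have htarget : ∀ K, ∃ L ∈ B.pieces, ¬ L.Subsingleton ∧ s '' L ⊆ T K := by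
    intro K
    have hpU : s.symm (p K) ∈ V \ ⋃₀ FC :=
      s.symm.mem_of_eq_self_off (s.symm_eq_self_off hs1) (hOQ K (hTO K (hpT K))).2
    obtain ⟨v, ⟨-, hv⟩, hLv⟩ := hs3 _ (B.q_mem_pieces _) (hUs.q_mem hpU)
    have hpv : p K ∈ v := hLv ⟨_, B.mem_q _, s.apply_symm_apply _⟩
    obtain ⟨L, hL, hLn, hLs⟩ := hB.dense (s ⁻¹' T K) ((hTo K).preimage s.continuous) _
      (B.q_mem_pieces (s.symm (p K))) (image_subset_iff.1 (hLv.trans (hv K hpv)))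
    exact ⟨L, hL, hLn, image_subset_iff.2 hLs⟩
  choose L hL hLn hLT using htarget
  choose k hk hkL using fun K => hshift K _ (h𝒦.2.1 s _ (hB.mem _ (hL K) (hLn K))) (hLT K)
  obtain ⟨H, hH1, hH2⟩ := exists_homeomorph_glue O hOdis k hk (by
    intro x
    by_cases hx : x ∈ V
    · exact Or.inl (hOd x hx)
    · refine Or.inr ⟨fun K hK => hx (hOV K hK), fun S hS => ?_⟩
      obtain ⟨N, hN, hNS⟩ := hE.boundary x hx S hS
      refine ⟨N, hN, ?_⟩
      rintro K ⟨y, hyK, hyN⟩ z hz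
      exact hNS y hyN z (hE.mono (Nat.zero_le _) (hOs K y hyK z hz)))
  have hHn : ∀ y, E (n + 2) y (H y) ∧ E (n + 2) (F.symm y) (F.symm (H y)) := by
    intro y
    by_cases hy : ∃ K, y ∈ O K
    · obtain ⟨K, hK⟩ := hy
      have hHK : H y ∈ O K := by
        rw [hH1 K y hK]
        exact (k K).mem_of_eq_self_off (hk K) hK
      exact ⟨hOs K _ hK _ hHK, hOs' K _ ⟨y, hK, rfl⟩ _ ⟨_, hHK, rfl⟩⟩
    · rw [hH2 y fun K hK => hy ⟨K, hK⟩]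
      exact ⟨hE.refl _ _, hE.refl _ _⟩
  have hsn : ∀ y, E (n + 2) y (s y) ∧ E (n + 2) (F.symm y) (F.symm (s y)) := by
    intro y
    by_cases hy : y ∈ V \ ⋃₀ FC
    · obtain ⟨g, ⟨-, hg1, hg2⟩, hyg, hsg⟩ := hs2 y hy
      exact ⟨hg1 _ hyg _ hsg, hg2 _ ⟨y, hyg, rfl⟩ _ ⟨_, hsg, rfl⟩⟩
    · rw [hs1 y hy]
      exact ⟨hE.refl _ _, hE.refl _ _⟩
  have hHU : ∀ y ∉ V \ ⋃₀ FC, H y = y := fun y hy => hH2 y fun K hK => hy (hOQ K hK).2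
  let F' : X ≃ₜ X := (F.trans H).trans s.symm
  have hF' : ∀ x, F' x = s.symm (H (F x)) := fun x => rfl
  have hF's : ∀ y, F'.symm y = F.symm (H.symm (s y)) := fun y => rfl
  have hoff : ∀ x, F x ∉ V \ ⋃₀ FC → F' x = F x := fun x hx => by
    rw [hF', hHU _ hx, s.symm_eq_self_off hs1 _ hx]
  have hF'C : ∀ K ∈ C, ∀ x ∈ K, F' x = F x := fun K hK x hx =>
    hoff x fun hx' => hx'.2 ⟨_, ⟨K, hK, rfl⟩, x, hx, rfl⟩
  have hF'K : ∀ K : ι, F' '' K.1 = L K := by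
    intro K
    have h1 : F' '' K.1 = s.symm '' (k K '' (F '' K.1)) := by
      rw [← image_comp, ← image_comp]
      refine image_congr fun x hx => ?_
      rw [hF', hH1 K _ (hKO K ⟨x, hx, rfl⟩)]
      rfl
    rw [h1, hkL, ← image_comp, Homeomorph.symm_comp_self, image_id]
  have hnear : ∀ x, E (n + 1) (F x) (F' x) := by
    intro x
    have h1 := (hsn (F' x)).1
    rw [hF', s.apply_symm_apply, ← hF'] at h1
    exact hE.trans (hHn (F x)).1 (hE.symm _ _ _ h1)
  have hnear' : ∀ y, E (n + 1) (F.symm y) (F'.symm y) := by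
    intro y
    have h1 := (hHn (H.symm (s y))).2
    rw [H.apply_symm_apply, ← hF's] at h1
    exact hE.trans (hsn y).2 (hE.symm _ _ _ h1)
  have hC' : ∀ K ∈ A.pieces, ¬ IsSmall (E m) K → K ∈ C ∪ range fun K : ι => K.1 := by
    intro K hK hKs
    by_cases hKC : K ∈ C
    · exact Or.inl hKC
    · exact Or.inr ⟨⟨K, hK, hKC, hKs⟩, rfl⟩
  have hnot : ∀ M, F'.symm '' M ∉ C ∪ range (fun K : ι => K.1) → F.symm '' M ∉ C := by
    intro M hM hMC
    refine hM (Or.inl ?_)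
    rw [← mem_image_image_iff] at hMC ⊢
    obtain ⟨K, hK, rfl⟩ := hMC
    exact ⟨K, hK, image_congr fun x hx => hF'C K hK x hx⟩
  refine ⟨F', C ∪ range fun K : ι => K.1, ⟨?_, ?_, ?_, ?_, ?_, ?_, ?_, ?_⟩,
    subset_union_left, hF'C, hnear, hnear'⟩
  · intro x hx
    have hFx := h.eq_self x hx
    rw [hoff x (by rw [hFx]; exact fun hx' => hx hx'.1), hFx]
  · rintro K (hK | ⟨K, rfl⟩)
    · exact h.subset hK
    · exact K.2.1
  · rintro K (hK | ⟨K, rfl⟩)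
    · rw [image_congr fun x hx => hF'C K hK x hx]
      exact h.image_mem K hK
    · rw [hF'K]
      exact hL K
  · intro x hx
    obtain ⟨N, hN, hf⟩ := h.locallyFinite x hx
    obtain ⟨N', hN', hd⟩ := hA.vanishing.discrete_of_not_isSmall hE hV m hx
    have hsub : {K | K ∈ (range fun K : ι => K.1) ∧ (K ∩ N').Nonempty}.Subsingleton := by
      rintro _ ⟨⟨K, rfl⟩, hK⟩ _ ⟨⟨K', rfl⟩, hK'⟩
      exact hd _ K.2.1 K.2.2.2 _ K'.2.1 K'.2.2.2 hK hK'
    refine ⟨N ∩ N', Filter.inter_mem hN hN', (hf.union hsub.finite).subset ?_⟩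
    rintro K ⟨hK | hK, hKN⟩
    · exact Or.inl ⟨hK, hKN.mono (inter_subset_inter_right _ inter_subset_left)⟩
    · exact Or.inr ⟨hK, hKN.mono (inter_subset_inter_right _ inter_subset_right)⟩
  · intro K hK hKC
    by_contra hKs
    exact hKC (hC' K hK hKs)
  · rintro K hK hKC _ ⟨x, hx, rfl⟩ _ ⟨y, hy, rfl⟩
    have h1 := h.small_image K hK (fun h' => hKC (Or.inl h')) _ ⟨x, hx, rfl⟩ _ ⟨y, hy, rfl⟩
    exact hE.trans₃ n _ _ _ _ (hE.symm _ _ _ (hnear x)) (hE.mono (by omega) h1) (hnear y)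
  · exact fun M hM hMC => h.small_right M hM (hnot M hMC)
  · rintro M hM hMC _ ⟨x, hx, rfl⟩ _ ⟨y, hy, rfl⟩
    have h1 := h.small_preimage M hM (hnot M hMC) _ ⟨x, hx, rfl⟩ _ ⟨y, hy, rfl⟩
    exact hE.trans₃ n _ _ _ _ (hE.symm _ _ _ (hnear' x)) (hE.mono (by omega) h1) (hnear' y)

end Matching

section Iteration

variable {X : Type*} [MetricSpace X] {V : Set X} {E : ℕ → X → X → Prop} {d : ℕ}
  {A B : Decomposition X} {F F' : X ≃ₜ X} {C C' : Set (Set X)} {n : ℕ} {𝒦 : Set (Set X)}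

lemma IsCloseExtension.of_swap {R : X → X → Prop}
    (h : IsCloseExtension R F.symm ((fun K => F '' K) '' C) F' C') :
    IsCloseExtension R F C F'.symm ((fun K => F' '' K) '' C') := by
  have h' := h.swap
  rwa [image_image_symm] at h'

/-- Improving a matching: all unmatched pieces become as small as desired. -/
lemma IsMatching.exists_refine (h𝒦 : IsTameFamily 𝒦) (hE : IsScale V E d)
    (hV : IsOpen V) (hA : A.IsMatchable 𝒦 V) (hB : B.IsMatchable 𝒦 V)
    (h : IsMatching A B V E F C (n + 7) (n + 7) (n + 7) (n + 7)) (m : ℕ) :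
    ∃ F' C', IsMatching A B V E F' C' m m m m ∧ IsCloseExtension (E n) F C F' C' := by
  obtain ⟨F₁, C₁, h₁, e₁⟩ := h.exists_match (n := n + 5) h𝒦 hE hV hA hB (m + n + 10)
    (by omega) (by omega) (by omega) (by omega)
  obtain ⟨F₂, C₂, h₂, e₂⟩ := h₁.swap.exists_match (n := n + 3) h𝒦 hE hV hB hA (m + n + 10)
    (by omega) (by omega) (by omega) (by omega)
  obtain ⟨F₃, h₃, e₃⟩ := h₂.swap.shrink (n := n + 2) hE hV hA (m + n + 10) (by omega) (by omega)
  obtain ⟨F₄, h₄, e₄⟩ := h₃.swap.shrink (n := m + n + 9) hE hV hB (m + n + 10)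
    (by omega) (by omega)
  refine ⟨F₄.symm, _, h₄.swap.mono hE (by omega) (by omega) (by omega) (by omega), ?_⟩
  rw [show min (m + n + 10) (n + 3) = n + 3 by omega] at e₃
  rw [show min (m + n + 10) (n + 2) = n + 2 by omega] at e₄
  have e₁₂ := (e₁.mono hE (by omega : n + 4 ≤ _)).trans hE
    (e₂.of_swap.mono hE (by omega : n + 4 ≤ _))
  have e₁₃ := e₁₂.trans hE e₃
  exact (e₁₃.trans hE e₄.of_swap).mono hE (by omega)

/-- A matching with no matched pieces. -/
lemma isMatching_refl (hA : ∀ P ∈ A.pieces, IsSmall (E n) P)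
    (hB : ∀ P ∈ B.pieces, IsSmall (E n) P) :
    IsMatching A B V E (Homeomorph.refl X) ∅ n n n n where
  eq_self _ _ := rfl
  subset := empty_subset _
  image_mem := by simp
  locallyFinite x _ := ⟨univ, Filter.univ_mem, by simp⟩
  small_left K hK _ := hA K hK
  small_image K hK _ := by simpa using hA K hK
  small_right K hK _ := hB K hK
  small_preimage K hK _ := by simpa [← Homeomorph.image_symm] using hB K hK

lemma IsScale.subsingleton_of_forall_isSmall (hE : IsScale V E d) {S : Set X}
    (h : ∀ k, IsSmall (E (d + 3 + k + 7)) S) : S.Subsingleton := by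
  intro x hx y hy
  refine eq_of_forall_dist_le fun ε hε => ?_
  obtain ⟨k, hk⟩ := exists_pow_lt_of_lt_one hε (by norm_num : (1 / 2 : ℝ) < 1)
  exact (hE.dist_le k x y (hE.mono (by omega) (h k x hx y hy))).trans hk.le

/-- The limit of a sequence of homeomorphisms converging uniformly with their inverses. -/
lemma exists_homeomorph_limit [CompleteSpace X] (f : ℕ → X ≃ₜ X)
    (h : ∀ n x, dist (f n x) (f (n + 1) x) ≤ (1 / 2) ^ n)
    (h' : ∀ n x, dist ((f n).symm x) ((f (n + 1)).symm x) ≤ (1 / 2) ^ n) :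
    ∃ g : X ≃ₜ X, ∀ x, Filter.Tendsto (fun n => f n x) Filter.atTop (𝓝 (g x)) := by
  have key : ∀ f : ℕ → X ≃ₜ X, ∀ g g' : X → X,
      (∀ x, Filter.Tendsto (fun n => f n x) Filter.atTop (𝓝 (g x))) → Continuous g' →
      (∀ n x, dist ((f n).symm x) (g' x) ≤ 2 * (1 / 2) ^ n) → ∀ x, g' (g x) = x := by
    intro f g g' hg hc hd x
    have h0 : Filter.Tendsto (fun n : ℕ => 2 * (1 / 2 : ℝ) ^ n) Filter.atTop (𝓝 0) := by
      simpa using (tendsto_pow_atTop_nhds_zero_of_lt_one (by norm_num : (0 : ℝ) ≤ 1 / 2)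
        (by norm_num)).const_mul 2
    refine tendsto_nhds_unique ((hc.tendsto _).comp (hg x)) ?_
    rw [tendsto_iff_dist_tendsto_zero]
    refine squeeze_zero (fun _ => dist_nonneg) (fun n => ?_) h0
    simpa [dist_comm] using hd n (f n x)
  obtain ⟨g, hc, hl, hd⟩ := exists_continuous_limit (fun n => (f n).continuous) h
  obtain ⟨g', hc', hl', hd'⟩ := exists_continuous_limit (fun n => (f n).symm.continuous) h'
  exact ⟨⟨⟨g, g', key f g g' hl hc' hd', key (fun n => (f n).symm) g' g hl' hc hd⟩, hc, hc'⟩, hl⟩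

/-- Decompositions into small pieces are equivalent by a small homeomorphism. -/
theorem exists_homeomorph_pieces [CompleteSpace X] (h𝒦 : IsTameFamily 𝒦) (hE : IsScale V E d)
    (hV : IsOpen V) (hA : A.IsMatchable 𝒦 V) (hB : B.IsMatchable 𝒦 V)
    (hAs : ∀ P ∈ A.pieces, IsSmall (E 9) P) (hBs : ∀ P ∈ B.pieces, IsSmall (E 9) P) :
    ∃ Φ : X ≃ₜ X, (∀ P ∈ A.pieces, Φ '' P ∈ B.pieces) ∧ ∀ x, E 1 x (Φ x) := by
  obtain ⟨F₀, C₀, h₀, e₀⟩ := (isMatching_refl (V := V) hAs hBs).exists_refine (n := 2) h𝒦 hE hV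
    hA hB (d + 3 + 0 + 7)
  obtain ⟨s, hs₀, hs, hs'⟩ := exists_dependent_seq (a₀ := (F₀, C₀))
    (P := fun k (s : (X ≃ₜ X) × Set (Set X)) => IsMatching A B V E s.1 s.2
      (d + 3 + k + 7) (d + 3 + k + 7) (d + 3 + k + 7) (d + 3 + k + 7))
    (R := fun k s t => IsCloseExtension (E (d + 3 + k)) s.1 s.2 t.1 t.2) h₀
    (fun k s hs => by
      obtain ⟨F', C', h, e⟩ := hs.exists_refine (n := d + 3 + k) h𝒦 hE hV hA hB
        (d + 3 + (k + 1) + 7)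
      exact ⟨(F', C'), h, e⟩)
  obtain ⟨Φ, hΦ⟩ := exists_homeomorph_limit (fun k => (s k).1)
    (fun k x => hE.dist_le k _ _ (hE.mono (by omega) ((hs' k).near x)))
    (fun k x => hE.dist_le k _ _ (hE.mono (by omega) ((hs' k).near_symm x)))
  have hCmono : Monotone fun k => (s k).2 := monotone_nat_of_le_succ fun k => (hs' k).subset
  have hCeq : ∀ k, ∀ K ∈ (s k).2, ∀ x ∈ K, Φ x = (s k).1 x := by
    intro k K hK x hx
    refine tendsto_nhds_unique (hΦ x) (tendsto_const_nhds.congr' ?_)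
    filter_upwards [Filter.eventually_ge_atTop k] with m hm
    induction m, hm using Nat.le_induction with
    | base => rfl
    | succ m hm ih => exact ih.trans ((hs' m).eqOn K (hCmono hm hK) x hx).symm
  have hCim : ∀ k, ∀ K ∈ (s k).2, Φ '' K = (s k).1 '' K := fun k K hK =>
    image_congr (hCeq k K hK)
  refine ⟨Φ, fun P hP => ?_, fun x => ?_⟩
  · by_cases hPC : ∃ k, P ∈ (s k).2
    · obtain ⟨k, hk⟩ := hPC
      rw [hCim k P hk]
      exact (hs k).image_mem P hk
    · push Not at hPC
      have hPs : P.Subsingleton := IsScale.subsingleton_of_forall_isSmall hE fun k =>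
        (hs k).small_left P hP (hPC k)
      obtain ⟨x, hx⟩ := A.nonempty' P hP
      obtain ⟨L, hL, hxL⟩ := B.covers (Φ x)
      have hLC : ∀ k, (s k).1.symm '' L ∉ (s k).2 := by
        intro k hk
        have hL' : Φ '' ((s k).1.symm '' L) = L := by
          rw [hCim k _ hk, ← image_comp, Homeomorph.self_comp_symm, image_id]
        rw [← hL'] at hxL
        obtain ⟨x', hx', hxx⟩ := hxL
        obtain rfl := Φ.injective hxx
        exact hPC k (Decomposition.eq_of_mem hP ((hs k).subset hk) hx hx' ▸ hk)
      have hLs : L.Subsingleton := IsScale.subsingleton_of_forall_isSmall hE fun k =>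
        (hs k).small_right L hL (hLC k)
      rw [hPs.eq_singleton_of_mem hx, image_singleton, ← hLs.eq_singleton_of_mem hxL]
      exact hL
  · by_cases hx : x ∈ V
    swap
    · rw [tendsto_nhds_unique (hΦ x) (tendsto_const_nhds.congr fun k =>
        ((hs k).eq_self x hx).symm)]
      exact hE.refl _ _
    have hΦV : Φ x ∈ V := Φ.mem_of_eq_self_off (fun y hy => tendsto_nhds_unique (hΦ y)
      (tendsto_const_nhds.congr fun k => ((hs k).eq_self y hy).symm)) hx
    have htail : ∀ k j, E (d + 2 + j) ((s j).1 x) ((s (j + k)).1 x) := by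
      intro k
      induction k with
      | zero => exact fun j => hE.refl _ _
      | succ k ih =>
        intro j
        refine hE.trans (hE.mono (by omega) ((hs' j).near x)) ?_
        have := ih (j + 1)
        rw [show j + 1 + k = j + (k + 1) by omega] at this
        exact hE.mono (by omega) this
    obtain ⟨O, hO, hxO, -, hOs⟩ := hE.exists_isSmall_nhds 2 hΦV
    obtain ⟨k, hk⟩ := ((hΦ x).eventually (hO.mem_nhds hxO)).exists
    have h1 : E 2 x ((s 0).1 x) := by
      rw [hs₀]
      exact e₀.near x
    have h2 := htail k 0
    rw [Nat.zero_add] at h2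
    exact hE.trans₃ 1 _ _ _ _ h1 (hE.mono (by omega) h2) (hOs _ hk _ hxO)

end Iteration

namespace Decomposition

/-- Saturated covers form a scale. -/
lemma Vanishing.exists_scale {X : Type*} [MetricSpace X] {D : Decomposition X} (hv : D.Vanishing)
    {V : Set X} (hV : IsOpen V) (hVs : D.Saturated V) {𝒲 : Set (Set X)} (h𝒲o : ∀ w ∈ 𝒲, IsOpen w)
    (h𝒲 : ∀ P ∈ D.pieces, P ⊆ V → ∃ w ∈ 𝒲, P ⊆ w) (N : ℕ) :
    ∃ 𝒢 : ℕ → Set (Set X), IsScale V (fun n => CoverNear (𝒢 n)) (N + 1) ∧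
      (∀ g ∈ 𝒢 0, ∃ w ∈ 𝒲, g ⊆ w) ∧ (∀ n ≤ N, ∀ g ∈ 𝒢 n, IsOpen g ∧ D.Saturated g) ∧
      ∀ n, ⋃₀ 𝒢 n = V := by
  obtain ⟨𝒢₀, h1, h2, h3⟩ := hv.exists_fine_cover hV h𝒲o h𝒲
  obtain ⟨𝒢, h𝒢0, h𝒢, hR⟩ := exists_dependent_seq (a₀ := 𝒢₀)
    (P := fun n (𝒢 : Set (Set X)) => (∀ g ∈ 𝒢, IsOpen g) ∧ ⋃₀ 𝒢 = V ∧ (n ≤ N → ∀ g ∈ 𝒢, D.Saturated g))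
    (R := fun n (𝒢 𝒢' : Set (Set X)) => StarRefines 𝒢' 𝒢 ∧
      (N ≤ n → ∀ g ∈ 𝒢', ∀ x ∈ g, ∀ y ∈ g, dist x y ≤ (1 / 2) ^ n))
    ⟨fun g hg => (h1 g hg).1, by
      refine Subset.antisymm (sUnion_subset fun g hg => (h1 g hg).2.2.1) fun x hx => ?_
      obtain ⟨g, hg, hPg⟩ := h2 _ (D.q_mem_pieces x) (hVs.q_mem hx)
      exact ⟨g, hg, hPg (D.mem_q x)⟩, fun _ g hg => (h1 g hg).2.1⟩ (by
    rintro n 𝒢 ⟨ho, hU, hs⟩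
    by_cases hn : n + 1 ≤ N
    · obtain ⟨𝒢', h, h', h''⟩ := hv.exists_star_refinement 𝒢 fun g hg =>
        ⟨ho g hg, hs (by omega) g hg⟩
      exact ⟨𝒢', ⟨fun g hg => (h g hg).1, h'.trans hU, fun _ g hg => (h g hg).2⟩, h'',
        fun hn' => absurd hn' (by omega)⟩
    · obtain ⟨𝒢', h, h', h''⟩ := exists_open_star_refinement
        {u | IsOpen u ∧ (∃ g ∈ 𝒢, u ⊆ g) ∧ ∀ x ∈ u, ∀ y ∈ u, dist x y ≤ (1 / 2) ^ n}
        fun u hu => hu.1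
      refine ⟨𝒢', ⟨h, h'.trans (Subset.antisymm ?_ ?_), fun hn' => absurd hn' hn⟩, ?_, ?_⟩
      · rintro x ⟨u, ⟨-, ⟨g, hg, hug⟩, -⟩, hx⟩
        exact hU ▸ ⟨g, hg, hug hx⟩
      · intro x hx
        rw [← hU] at hx
        obtain ⟨g, hg, hxg⟩ := hx
        have hr : (0 : ℝ) < (1 / 2) ^ n / 2 := by positivity
        refine ⟨g ∩ Metric.ball x ((1 / 2) ^ n / 2), ⟨(ho g hg).inter Metric.isOpen_ball,
          ⟨g, hg, inter_subset_left⟩, fun y hy z hz => ?_⟩, hxg, Metric.mem_ball_self hr⟩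
        linarith [dist_triangle_right y z x, Metric.mem_ball.1 hy.2, Metric.mem_ball.1 hz.2]
      · intro g hg hgn
        obtain ⟨w, ⟨-, ⟨g₀, hg₀, hwg⟩, -⟩, hw⟩ := h'' g hg hgn
        exact ⟨g₀, hg₀, fun g' hg' hgg => (hw g' hg' hgg).trans hwg⟩
      · intro _ g hg x hx y hy
        obtain ⟨w, ⟨-, -, hwd⟩, hw⟩ := h'' g hg ⟨x, hx⟩
        have := hw g hg ⟨x, hx, hx⟩
        exact hwd x (this hx) y (this hy))
  refine ⟨𝒢, ⟨fun n => CoverNear.refl _, fun n x y => CoverNear.symm,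
    fun n x y z w => (hR n).1.trans₃, fun n => ?_, fun n x y => ?_, ?_⟩,
    fun g hg => (h1 g (h𝒢0 ▸ hg)).2.2.2, fun n hn g hg => ⟨(h𝒢 n).1 g hg, (h𝒢 n).2.2 hn g hg⟩,
    fun n => (h𝒢 n).2.1⟩
  · have : {p : X × X | p.1 ∈ V ∧ p.2 ∈ V ∧ CoverNear (𝒢 n) p.1 p.2} = ⋃ g ∈ 𝒢 n, g ×ˢ g := by
      ext ⟨x, y⟩
      simp only [mem_ofPred_eq, mem_iUnion, mem_prod, exists_prop]
      rw [← (h𝒢 n).2.1]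
      constructor
      · rintro ⟨hx, -, h⟩
        exact h.exists_mem hx
      · rintro ⟨g, hg, hx, hy⟩
        exact ⟨⟨g, hg, hx⟩, ⟨g, hg, hy⟩, Or.inr ⟨g, hg, hx, hy⟩⟩
    rw [this]
    exact isOpen_biUnion fun g hg => ((h𝒢 n).1 g hg).prod ((h𝒢 n).1 g hg)
  · rintro (rfl | ⟨g, hg, hx, hy⟩)
    · rw [dist_self]
      positivity
    · exact ((hR (n + N)).2 (by omega) g hg x hx y hy).trans
        (pow_le_pow_of_le_one (by norm_num) (by norm_num) (by omega))
  · intro x hx O hO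
    obtain ⟨M, hM, h⟩ := h3 x hx O hO
    refine ⟨M ∩ O, Filter.inter_mem hM hO, ?_⟩
    rintro y hy z (rfl | ⟨g, hg, hyg, hzg⟩)
    · exact hy.2
    · exact h g (h𝒢0 ▸ hg) ⟨y, hyg, hy.1⟩ hzg

section Map

variable {X : Type*} [TopologicalSpace X] {D A B : Decomposition X}

/-- The image of a decomposition under a homeomorphism. -/
def map (D : Decomposition X) (F : X ≃ₜ X) : Decomposition X where
  pieces := (fun P => F '' P) '' D.pieces
  nonempty' := by
    rintro _ ⟨P, hP, rfl⟩
    exact (D.nonempty' P hP).image F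
  isCompact' := by
    rintro _ ⟨P, hP, rfl⟩
    exact (D.isCompact' P hP).image F.continuous
  disjoint' := by
    rintro _ ⟨P, hP, rfl⟩ _ ⟨Q, hQ, rfl⟩ h
    exact disjoint_image_of_injective F.injective (D.disjoint' P hP Q hQ fun hPQ => h (by rw [hPQ]))
  covers x := ⟨_, ⟨_, D.q_mem_pieces (F.symm x), rfl⟩, F.symm x, D.mem_q _, F.apply_symm_apply x⟩

lemma Vanishing.map (hv : D.Vanishing) (F : X ≃ₜ X) : (D.map F).Vanishing := by
  intro 𝒰 h𝒰o h𝒰 x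
  obtain ⟨N, hN, h⟩ := hv ((fun u => F ⁻¹' u) '' 𝒰) (by
    rintro _ ⟨u, hu, rfl⟩
    exact (h𝒰o u hu).preimage F.continuous) (by
    refine eq_univ_of_forall fun y => ?_
    obtain ⟨u, hu, hy⟩ := h𝒰.symm ▸ mem_univ (F y)
    exact ⟨_, ⟨u, hu, rfl⟩, hy⟩) (F.symm x)
  have hb : ∀ P, (∀ u ∈ 𝒰, ¬ F '' P ⊆ u) → ∀ u ∈ (fun u => F ⁻¹' u) '' 𝒰, ¬ P ⊆ u := by
    rintro P hP _ ⟨u, hu, rfl⟩ hPu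
    exact hP u hu (image_subset_iff.2 hPu)
  have hm : ∀ P, (F.symm ⁻¹' N ∩ F '' P).Nonempty → (N ∩ P).Nonempty := by
    rintro P ⟨_, hy, z, hz, rfl⟩
    exact ⟨z, by rwa [mem_preimage, F.symm_apply_apply] at hy, hz⟩
  refine ⟨F.symm ⁻¹' N, F.symm.continuous.continuousAt hN, ?_⟩
  rintro _ ⟨P, hP, rfl⟩ hPu _ ⟨Q, hQ, rfl⟩ hQu hPN hQN
  exact congrArg (F '' ·) (h P hP (hb P hPu) Q hQ (hb Q hQu) (hm P hPN) (hm Q hQN))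

/-- A homeomorphism mapping pieces to pieces descends to the decomposition spaces. -/
lemma exists_space_homeomorph (Ψ : X ≃ₜ X) (h : ∀ P ∈ A.pieces, Ψ '' P ∈ B.pieces) :
    ∃ φ : A.Space ≃ₜ B.Space, (∀ x, B.q (Ψ x) = φ (A.q x)) ∧ φ '' A.nondeg = B.nondeg := by
  have h' : ∀ Q ∈ B.pieces, Ψ.symm '' Q ∈ A.pieces := by
    intro Q hQ
    obtain ⟨y, hy⟩ := B.nonempty' Q hQ
    have : Q = Ψ '' (A.q (Ψ.symm y)).1 := eq_of_mem hQ (h _ (A.q_mem_pieces _)) hy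
      ⟨_, A.mem_q _, Ψ.apply_symm_apply y⟩
    rw [this, ← image_comp, Homeomorph.symm_comp_self, image_id]
    exact A.q_mem_pieces _
  have hq : ∀ x, B.q (Ψ x) = ⟨Ψ '' (A.q x).1, h _ (A.q x).2⟩ := fun x =>
    q_eq_of_mem _ ⟨x, A.mem_q x, rfl⟩
  have hq' : ∀ y, A.q (Ψ.symm y) = ⟨Ψ.symm '' (B.q y).1, h' _ (B.q y).2⟩ := fun y =>
    q_eq_of_mem _ ⟨y, B.mem_q y, rfl⟩
  refine ⟨⟨⟨fun P => ⟨Ψ '' P.1, h _ P.2⟩, fun Q => ⟨Ψ.symm '' Q.1, h' _ Q.2⟩, fun P => ?_,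
    fun Q => ?_⟩, continuous_iff.2 ?_, continuous_iff.2 ?_⟩, hq, ?_⟩
  · exact Subtype.ext (by simp only [← image_comp, Homeomorph.symm_comp_self, image_id])
  · exact Subtype.ext (by simp only [← image_comp, Homeomorph.self_comp_symm, image_id])
  · exact (continuous_q.comp Ψ.continuous).congr hq
  · exact (continuous_q.comp Ψ.symm.continuous).congr hq'
  · ext Q
    constructor
    · rintro ⟨P, hP, rfl⟩ hs
      exact hP ((Ψ.injective.subsingleton_image_iff).1 hs)
    · intro hQ
      refine ⟨⟨Ψ.symm '' Q.1, h' _ Q.2⟩, fun hs =>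
        hQ ((Ψ.symm.injective.subsingleton_image_iff).1 hs), Subtype.ext ?_⟩
      change Ψ '' (Ψ.symm '' Q.1) = Q.1
      rw [← image_comp, Homeomorph.self_comp_symm, image_id]

end Map

lemma AmbientShrinkable.map {X : Type*} [MetricSpace X] {D : Decomposition X}
    (hs : D.AmbientShrinkable) (F : X ≃ₜ X) :
    (D.map F).AmbientShrinkable := by
  intro U hU hUs 𝒢 h𝒢o h𝒢 𝒱 h𝒱o h𝒱
  obtain ⟨h, hid, hn, hv⟩ := hs (F ⁻¹' U) (hU.preimage F.continuous)
    (by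
      rintro P hP ⟨x, hxP, hxU⟩
      exact image_subset_iff.1 (hUs _ ⟨P, hP, rfl⟩ ⟨F x, ⟨x, hxP, rfl⟩, hxU⟩))
    ((fun g => F ⁻¹' g) '' 𝒢)
    (by
      rintro _ ⟨g, hg, rfl⟩
      exact (h𝒢o g hg).preimage F.continuous)
    (by
      intro P hP hPU
      obtain ⟨g, hg, hPg⟩ := h𝒢 _ ⟨P, hP, rfl⟩ (image_subset_iff.2 hPU)
      exact ⟨_, ⟨g, hg, rfl⟩, image_subset_iff.1 hPg⟩)
    ((fun v => F ⁻¹' v) '' 𝒱)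
    (by
      rintro _ ⟨v, hv, rfl⟩
      exact (h𝒱o v hv).preimage F.continuous)
    (by
      intro x hx
      obtain ⟨v, hv, hxv⟩ := h𝒱 hx
      exact ⟨_, ⟨v, hv, rfl⟩, hxv⟩)
  refine ⟨F.symm.trans (h.trans F), fun x hx => ?_, fun x hx => ?_, ?_⟩
  · change F (h (F.symm x)) = x
    rw [hid _ (by rwa [mem_preimage, F.apply_symm_apply]), F.apply_symm_apply]
  · obtain ⟨_, ⟨g, hg, rfl⟩, hxg, hhg⟩ := hn (F.symm x)
      (by rwa [mem_preimage, F.apply_symm_apply])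
    rw [mem_preimage, F.apply_symm_apply] at hxg
    exact ⟨g, hg, hxg, hhg⟩
  · rintro _ ⟨P, hP, rfl⟩ hPU
    obtain ⟨_, ⟨v, hv, rfl⟩, hPv⟩ := hv P hP (image_subset_iff.1 hPU)
    refine ⟨v, hv, ?_⟩
    rintro _ ⟨_, ⟨x, hx, rfl⟩, rfl⟩
    change F (h (F.symm (F x))) ∈ v
    rw [F.symm_apply_apply]
    exact hPv ⟨x, hx, rfl⟩

lemma Vanishing.exists_nondeg_subset {X : Type*} [MetricSpace X] {D : Decomposition X}
    (hv : D.Vanishing) (hd : D.IsDenseDecomp) {O : Set X}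
    (hO : IsOpen O) {P : Set X} (hP : P ∈ D.pieces) (hPO : P ⊆ O) :
    ∃ Q ∈ D.pieces, ¬ Q.Subsingleton ∧ Q ⊆ O := by
  have ho : IsOpen (D.q '' D.core O) := by
    rw [isOpen_iff, core_saturated.preimage_image]
    exact hv.isOpen_core hO
  obtain ⟨x, hx⟩ := D.nonempty' P hP
  obtain ⟨_, ⟨y, hy, rfl⟩, hQ⟩ := hd.inter_open_nonempty _ ho ⟨_, x, subset_core hP hPO hx, rfl⟩
  exact ⟨_, D.q_mem_pieces y, hQ, hy⟩

end Decomposition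

/-- Theorem: for dense `𝒦`-tame decompositions `A`, `B` of a strongly locally homogeneous
completely metrizable space, the `(A,B)`-liftable homeomorphisms are dense in the space
`H°(A°,B°)` of homeomorphisms of pairs, with the strong limitation topology. -/
theorem liftable_dense_pairs (X : Type*) [TopologicalSpace X]
    (hX : CompletelyMetrizable X) (hslh : StronglyLocallyHomogeneous X)
    (𝒦 : Set (Set X)) (h𝒦 : IsTameFamily 𝒦)
    (A B : Decomposition X) (hA : A.KTame 𝒦) (hAd : A.IsDenseDecomp)
    (hB : B.KTame 𝒦) (hBd : B.IsDenseDecomp) :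
    ∀ f : A.Space ≃ₜ B.Space, ⇑f '' A.nondeg = B.nondeg →
      ∀ 𝒲 : Set (Set B.Space), (∀ w ∈ 𝒲, IsOpen w) → B.nondeg ⊆ ⋃₀ 𝒲 →
        ∃ φ : A.Space ≃ₜ B.Space, Liftable A B φ ∧ ⇑φ '' A.nondeg = B.nondeg ∧
          Near ⇑f ⇑φ 𝒲 := by
  obtain ⟨m, rfl, hc⟩ := hX
  intro f hf 𝒲 h𝒲o h𝒲
  have hAn : ∀ P (hP : P ∈ A.pieces), ¬ P.Subsingleton → f ⟨P, hP⟩ ∈ ⋃₀ 𝒲 := fun P hP hs =>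
    h𝒲 (hf ▸ mem_image_of_mem f hs)
  have h𝒲U : IsOpen (⋃₀ 𝒲) := isOpen_sUnion h𝒲o
  set V : Set X := B.q ⁻¹' ⋃₀ 𝒲 with hVdef
  have hV : IsOpen V := h𝒲U.preimage Decomposition.continuous_q
  have hVn : ∀ P ∈ B.pieces, ¬ P.Subsingleton → P ⊆ V := fun P hP hs x hx => by
    rw [hVdef, mem_preimage, Decomposition.q_eq_of_mem hP hx]
    exact h𝒲 hs
  have hVs : B.Saturated V := Decomposition.saturated_preimage _
  set U : Set X := A.q ⁻¹' (f ⁻¹' ⋃₀ 𝒲) with hUdef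
  have hU : IsOpen U := (h𝒲U.preimage f.continuous).preimage Decomposition.continuous_q
  have hUn : ∀ P ∈ A.pieces, ¬ P.Subsingleton → P ⊆ U := fun P hP hs x hx => by
    rw [hUdef, mem_preimage, mem_preimage, Decomposition.q_eq_of_mem hP hx]
    exact hAn P hP hs
  have hUV : ∀ x z, B.q z = f (A.q x) → (x ∈ U ↔ z ∈ V) := fun x z h => by
    rw [hUdef, hVdef, mem_preimage, mem_preimage, mem_preimage, h]
  obtain ⟨𝒢, hE, h𝒢0, h𝒢, h𝒢V⟩ := hB.1.exists_scale hV hVs (𝒲 := (fun w => B.q ⁻¹' w) '' 𝒲)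
    (by
      rintro _ ⟨w, hw, rfl⟩
      exact (h𝒲o w hw).preimage Decomposition.continuous_q)
    (by
      intro P hP hPV
      obtain ⟨x, hx⟩ := B.nonempty' P hP
      obtain ⟨w, hw, hxw⟩ := hPV hx
      exact ⟨_, ⟨w, hw, rfl⟩, Decomposition.saturated_preimage w P hP ⟨x, hx, hxw⟩⟩) 12
  have h𝒢P : ∀ n ≤ 12, ∀ x ∈ V, ∃ g ∈ 𝒢 n, (B.q x).1 ⊆ g := by
    intro n hn x hx
    obtain ⟨g, hg, hxg⟩ := (h𝒢V n).symm ▸ hx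
    exact ⟨g, hg, ((h𝒢 n hn g hg).2).q_mem hxg⟩
  obtain ⟨G, hG, hG'⟩ := hB.1.exists_homeomorph_space (hB.1.ambientShrinkable hB.2.1) hV hVn
    (𝒢 := 𝒢 12) (fun g hg => (h𝒢 12 le_rfl g hg).1) (fun P hP hPV => by
      obtain ⟨x, hx⟩ := B.nonempty' P hP
      have := h𝒢P 12 le_rfl x (hPV hx)
      rwa [Decomposition.q_eq_of_mem hP hx] at this)
  obtain ⟨H, hH, hH'⟩ := hA.1.exists_homeomorph_space (hA.1.ambientShrinkable hA.2.1) hU hUn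
    (𝒢 := (fun g => A.q ⁻¹' (f ⁻¹' (B.q '' g))) '' 𝒢 12)
    (by
      rintro _ ⟨g, hg, rfl⟩
      refine IsOpen.preimage Decomposition.continuous_q (IsOpen.preimage f.continuous ?_)
      rw [Decomposition.isOpen_iff, ((h𝒢 12 le_rfl g hg).2).preimage_image]
      exact (h𝒢 12 le_rfl g hg).1)
    (by
      intro P hP hPU
      obtain ⟨x, hx⟩ := A.nonempty' P hP
      obtain ⟨z, hz⟩ := Decomposition.q_surjective (f (A.q x))
      obtain ⟨g, hg, hzg⟩ := h𝒢P 12 le_rfl z ((hUV x z hz).1 (hPU hx))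
      refine ⟨_, ⟨g, hg, rfl⟩, fun y hy => ⟨z, hzg (B.mem_q z), ?_⟩⟩
      rw [hz, Decomposition.q_eq_of_mem hP hx, Decomposition.q_eq_of_mem hP hy])
  set F : X ≃ₜ X := H.symm.trans (f.trans G) with hF
  have hFnear : ∀ x z, B.q z = f (A.q x) → CoverNear (𝒢 11) z (F x) := by
    intro x z hz
    by_cases hx : x ∈ U
    · obtain ⟨y, hy⟩ := Decomposition.q_surjective (H.symm x)
      obtain ⟨u, hu⟩ := Decomposition.q_surjective (f (A.q y))
      have hHy : H (A.q y) = x := by rw [hy, H.apply_symm_apply]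
      have hFx : F x = G (B.q u) := by rw [hu, hy, hF]; rfl
      have hyU : y ∈ U := by
        by_contra hyU
        rw [hH y hyU] at hHy
        exact hyU (hHy ▸ hx)
      obtain ⟨-, _, ⟨g, hg, rfl⟩, ⟨u', hu', hu''⟩, ⟨z', hz', hz''⟩⟩ := hH' y hyU
      rw [hHy, ← hz] at hz''
      rw [← hu] at hu''
      have hgs := (h𝒢 12 le_rfl g hg).2
      have hzg : z ∈ g := hgs.q_mem hz' (Decomposition.q_eq_iff.1 hz''.symm)
      have hug : u ∈ g := hgs.q_mem hu' (Decomposition.q_eq_iff.1 hu''.symm)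
      obtain ⟨-, g', hg', hug', hGg'⟩ := hG' u ((hUV y u hu).1 hyU)
      rw [hFx]
      exact hE.trans (n := 11) (Or.inr ⟨g, hg, hzg, hug⟩) (Or.inr ⟨g', hg', hug', hGg'⟩)
    · have : F x = z := by
        have h : H.symm x = A.q x := by rw [H.symm_apply_eq, hH x hx]
        rw [← hG z fun hz' => hx ((hUV x z hz).2 hz'), hz, ← h]
        rfl
      rw [this]
      exact CoverNear.refl _ _
  have hFUV : ∀ x ∈ U, F x ∈ V := by
    intro x hx
    obtain ⟨z, hz⟩ := Decomposition.q_surjective (f (A.q x))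
    by_contra hFx
    exact hFx (hE.eq_of_notMem (n := 11) (hFnear x z hz).symm hFx ▸ (hUV x z hz).1 hx)
  have hBm : B.IsMatchable 𝒦 V := ⟨hB.1, hB.1.ambientShrinkable hB.2.1, hB.2.2, hVn,
    fun O hO P hP hPO => hB.1.exists_nondeg_subset hBd hO hP hPO⟩
  have hAm : (A.map F).IsMatchable 𝒦 V := by
    refine ⟨hA.1.map F, (hA.1.ambientShrinkable hA.2.1).map F, ?_, ?_, ?_⟩
    · rintro _ ⟨P, hP, rfl⟩ hs
      exact h𝒦.2.1 F P (hA.2.2 P hP fun h => hs (h.image F))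
    · rintro _ ⟨P, hP, rfl⟩ hs _ ⟨x, hx, rfl⟩
      exact hFUV x (hUn P hP (fun h => hs (h.image F)) hx)
    · rintro O hO _ ⟨P, hP, rfl⟩ hPO
      obtain ⟨Q, hQ, hQs, hQO⟩ := hA.1.exists_nondeg_subset hAd (hO.preimage F.continuous) hP
        (image_subset_iff.1 hPO)
      exact ⟨_, ⟨Q, hQ, rfl⟩, fun h => hQs (F.injective.subsingleton_image_iff.1 h),
        image_subset_iff.2 hQO⟩
  obtain ⟨Φ, hΦ, hΦn⟩ := exists_homeomorph_pieces h𝒦 hE hV hAm hBm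
    (by
      rintro _ ⟨P, hP, rfl⟩ _ ⟨x, hx, rfl⟩ _ ⟨y, hy, rfl⟩
      obtain ⟨z, hz⟩ := Decomposition.q_surjective (f (A.q x))
      have hz' : B.q z = f (A.q y) := by
        rw [hz, Decomposition.q_eq_of_mem hP hx, Decomposition.q_eq_of_mem hP hy]
      exact hE.mono (by norm_num : 9 ≤ 10) (hE.trans (n := 10) (hFnear x z hz).symm
        (hFnear y z hz')))
    (by
      intro P hP
      by_cases hs : P.Subsingleton
      · exact hE.isSmall_of_subsingleton 9 hs
      · intro x hx y hy
        obtain ⟨g, hg, hPg⟩ := h𝒢P 9 (by norm_num) x (hVn P hP hs hx)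
        rw [Decomposition.q_eq_of_mem hP hx] at hPg
        exact Or.inr ⟨g, hg, hPg hx, hPg hy⟩)
  obtain ⟨φ, hφ, hφn⟩ := Decomposition.exists_space_homeomorph (A := A) (B := B) (F.trans Φ)
    (fun P hP => by
      rw [show ⇑(F.trans Φ) = Φ ∘ F from rfl, image_comp]
      exact hΦ _ ⟨P, hP, rfl⟩)
  refine ⟨φ, ⟨F.trans Φ, hφ⟩, hφn, fun P hne => ?_⟩
  obtain ⟨x, rfl⟩ := Decomposition.q_surjective P
  obtain ⟨z, hz⟩ := Decomposition.q_surjective (f (A.q x))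
  rw [← hz, ← hφ x] at hne ⊢
  rcases hE.trans (n := 0) (hE.mono (by norm_num : 1 ≤ 11) (hFnear x z hz)) (hΦn (F x)) with
    h | ⟨g, hg, hzg, hxg⟩
  · exact absurd (congrArg B.q h) hne
  · obtain ⟨_, ⟨w, hw, rfl⟩, hgw⟩ := h𝒢0 g hg
    exact ⟨w, hw, hgw hzg, hgw hxg⟩


end
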